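/- arXiv:1411.3655 — 2 statements merged into one kernel-verified Lean document; each statement's English description precedes it below -/
import Mathlib

section
/- The only rational solution with x > 0 and y > 0 to the equation y^2 = x^6 + x^2 + 1 is (x, y) = (1/2, 9/8). In other words, if x, y are positive rational numbers satisfying y^2 = x^6 + x^2 + 1, then x = 1/2 and y = 9/8. -/
/-- The cubic order `ℤ[α]` with `α ^ 3 + α + 1 = 0`; the triple `⟨x, y, z⟩` stands for
`x + y α + z α ^ 2`. -/
@[ext]
structure CubicInt where
  x : ℤ
  y : ℤ
  z : ℤ

namespace CubicInt

instance : DecidableEq CubicInt := fun _ _ => decidable_of_iff _ CubicInt.ext_iff.symm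

instance : Zero CubicInt := ⟨⟨0, 0, 0⟩⟩
instance : One CubicInt := ⟨⟨1, 0, 0⟩⟩
instance : Add CubicInt := ⟨fun u v => ⟨u.x + v.x, u.y + v.y, u.z + v.z⟩⟩
instance : Neg CubicInt := ⟨fun u => ⟨-u.x, -u.y, -u.z⟩⟩
instance : Sub CubicInt := ⟨fun u v => ⟨u.x - v.x, u.y - v.y, u.z - v.z⟩⟩
instance : Mul CubicInt := ⟨fun u v =>
  ⟨u.x * v.x - (u.y * v.z + u.z * v.y),
    u.x * v.y + u.y * v.x - (u.y * v.z + u.z * v.y) - u.z * v.z,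
    u.x * v.z + u.y * v.y + u.z * v.x - u.z * v.z⟩⟩
instance : NatCast CubicInt := ⟨fun n => ⟨n, 0, 0⟩⟩
instance : IntCast CubicInt := ⟨fun n => ⟨n, 0, 0⟩⟩

@[simp] lemma zero_x : (0 : CubicInt).x = 0 := rfl
@[simp] lemma zero_y : (0 : CubicInt).y = 0 := rfl
@[simp] lemma zero_z : (0 : CubicInt).z = 0 := rfl
@[simp] lemma one_x : (1 : CubicInt).x = 1 := rfl
@[simp] lemma one_y : (1 : CubicInt).y = 0 := rfl
@[simp] lemma one_z : (1 : CubicInt).z = 0 := rfl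
@[simp] lemma add_x (u v : CubicInt) : (u + v).x = u.x + v.x := rfl
@[simp] lemma add_y (u v : CubicInt) : (u + v).y = u.y + v.y := rfl
@[simp] lemma add_z (u v : CubicInt) : (u + v).z = u.z + v.z := rfl
@[simp] lemma neg_x (u : CubicInt) : (-u).x = -u.x := rfl
@[simp] lemma neg_y (u : CubicInt) : (-u).y = -u.y := rfl
@[simp] lemma neg_z (u : CubicInt) : (-u).z = -u.z := rfl
@[simp] lemma sub_x (u v : CubicInt) : (u - v).x = u.x - v.x := rfl
@[simp] lemma sub_y (u v : CubicInt) : (u - v).y = u.y - v.y := rfl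
@[simp] lemma sub_z (u v : CubicInt) : (u - v).z = u.z - v.z := rfl
@[simp] lemma mul_x (u v : CubicInt) :
    (u * v).x = u.x * v.x - (u.y * v.z + u.z * v.y) := rfl
@[simp] lemma mul_y (u v : CubicInt) :
    (u * v).y = u.x * v.y + u.y * v.x - (u.y * v.z + u.z * v.y) - u.z * v.z := rfl
@[simp] lemma mul_z (u v : CubicInt) :
    (u * v).z = u.x * v.z + u.y * v.y + u.z * v.x - u.z * v.z := rfl
@[simp] lemma natCast_x (n : ℕ) : (n : CubicInt).x = n := rfl
@[simp] lemma natCast_y (n : ℕ) : (n : CubicInt).y = 0 := rfl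
@[simp] lemma natCast_z (n : ℕ) : (n : CubicInt).z = 0 := rfl
@[simp] lemma intCast_x (n : ℤ) : (n : CubicInt).x = n := rfl
@[simp] lemma intCast_y (n : ℤ) : (n : CubicInt).y = 0 := rfl
@[simp] lemma intCast_z (n : ℤ) : (n : CubicInt).z = 0 := rfl

instance : CommRing CubicInt where
  add_assoc _ _ _ := by ext <;> simp <;> ring
  zero_add _ := by ext <;> simp
  add_zero _ := by ext <;> simp
  add_comm _ _ := by ext <;> simp <;> ring
  mul_assoc _ _ _ := by ext <;> simp <;> ring
  one_mul _ := by ext <;> simp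
  mul_one _ := by ext <;> simp
  mul_comm _ _ := by ext <;> simp <;> ring
  left_distrib _ _ _ := by ext <;> simp <;> ring
  right_distrib _ _ _ := by ext <;> simp <;> ring
  zero_mul _ := by ext <;> simp
  mul_zero _ := by ext <;> simp
  neg_add_cancel _ := by ext <;> simp
  sub_eq_add_neg _ _ := by ext <;> simp <;> ring
  nsmul := nsmulRec
  zsmul := zsmulRec
  natCast_zero := by ext <;> simp
  natCast_succ _ := by ext <;> simp
  intCast_ofNat _ := by ext <;> simp
  intCast_negSucc _ := by ext <;> simp [Int.negSucc_eq]

@[simp] lemma ofNat_x (n : ℕ) [n.AtLeastTwo] : (ofNat(n) : CubicInt).x = OfNat.ofNat n := rfl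
@[simp] lemma ofNat_y (n : ℕ) [n.AtLeastTwo] : (ofNat(n) : CubicInt).y = 0 := rfl
@[simp] lemma ofNat_z (n : ℕ) [n.AtLeastTwo] : (ofNat(n) : CubicInt).z = 0 := rfl

/-- The generator `α` of the order. -/
def α : CubicInt := ⟨0, 1, 0⟩

/-- The inverse of `α`. -/
def β : CubicInt := ⟨-1, 0, -1⟩

@[simp] lemma α_x : α.x = 0 := rfl
@[simp] lemma α_y : α.y = 1 := rfl
@[simp] lemma α_z : α.z = 0 := rfl

lemma α_mul_β : α * β = 1 := by decide

lemma β_eq : β = -1 - α ^ 2 := by decide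

/-- The product of the two other conjugates. -/
def adj (u : CubicInt) : CubicInt :=
  ⟨(u.x - u.z) ^ 2 + u.y * u.z + u.y ^ 2, -(u.x * u.y + u.z ^ 2), u.y ^ 2 - u.x * u.z + u.z ^ 2⟩

/-- The norm from the order to `ℤ`. -/
def norm (u : CubicInt) : ℤ :=
  u.x * ((u.x - u.z) ^ 2 + u.y * u.z + u.y ^ 2) + u.z * (u.x * u.y + u.z ^ 2)
    - u.y * (u.y ^ 2 - u.x * u.z + u.z ^ 2)

lemma mul_adj (u : CubicInt) : u * adj u = (norm u : CubicInt) := by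
  ext <;> simp only [mul_x, mul_y, mul_z, intCast_x, intCast_y, intCast_z, adj, norm] <;> ring

lemma norm_mul (u v : CubicInt) : norm (u * v) = norm u * norm v := by
  simp [norm]; ring

lemma dvd_iff (n : ℤ) (u : CubicInt) : (n : CubicInt) ∣ u ↔ n ∣ u.x ∧ n ∣ u.y ∧ n ∣ u.z := by
  constructor
  · rintro ⟨v, rfl⟩
    simp
  · rintro ⟨⟨a, ha⟩, ⟨b, hb⟩, ⟨c, hc⟩⟩
    exact ⟨⟨a, b, c⟩, by ext <;> simp [*]⟩

lemma two_dvd_iff (u : CubicInt) : 2 ∣ u ↔ 2 ∣ u.x ∧ 2 ∣ u.y ∧ 2 ∣ u.z := dvd_iff 2 u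

lemma two_dvd_of_two_dvd_norm {u : CubicInt} (h : 2 ∣ norm u) : 2 ∣ u := by
  rw [two_dvd_iff]
  simp only [norm] at h
  rcases Int.even_or_odd' u.x with ⟨a, ha | ha⟩ <;> rcases Int.even_or_odd' u.y with ⟨b, hb | hb⟩ <;>
    rcases Int.even_or_odd' u.z with ⟨c, hc | hc⟩ <;> rw [ha, hb, hc] at h ⊢ <;>
    first
    | exact ⟨⟨_, rfl⟩, ⟨_, rfl⟩, ⟨_, rfl⟩⟩
    | (exfalso; revert h; ring_nf; omega)

lemma norm_ne_zero {u : CubicInt} (hu : u ≠ 0) : norm u ≠ 0 := by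
  intro h
  have key : ∀ n : ℕ, (2 : CubicInt) ^ n ∣ u := by
    intro n
    induction n with
    | zero => simp
    | succ n ih =>
      obtain ⟨v, hv⟩ := ih
      have hv0 : norm v = 0 := by
        have h2 : norm ((2 : CubicInt) ^ n) ≠ 0 := by
          clear hv
          induction n with
          | zero => decide
          | succ n ih => rw [pow_succ, norm_mul]; exact mul_ne_zero ih (by decide)
        rw [hv, norm_mul] at h
        exact (mul_eq_zero.mp h).resolve_left h2
      obtain ⟨w, hw⟩ := two_dvd_of_two_dvd_norm (u := v) (by simp [hv0])
      exact ⟨w, by rw [hv, hw, pow_succ]; ring⟩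
  apply hu
  have hz : ∀ t : ℤ, (∀ n : ℕ, (2 : ℤ) ^ n ∣ t) → t = 0 := by
    intro t ht
    refine Int.eq_zero_of_abs_lt_dvd (ht t.natAbs) ?_
    rw [Int.abs_eq_natAbs]
    exact_mod_cast Nat.lt_two_pow_self
  have hk : ∀ n : ℕ, (2 : ℤ) ^ n ∣ u.x ∧ (2 : ℤ) ^ n ∣ u.y ∧ (2 : ℤ) ^ n ∣ u.z := by
    intro n
    rw [← dvd_iff]
    exact_mod_cast key n
  ext
  · exact hz _ fun n => (hk n).1
  · exact hz _ fun n => (hk n).2.1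
  · exact hz _ fun n => (hk n).2.2

instance : Nontrivial CubicInt := ⟨0, 1, by decide⟩

instance : IsDomain CubicInt := by
  have : NoZeroDivisors CubicInt := ⟨by
    intro u v h
    by_contra! hc
    have := congrArg norm h
    rw [norm_mul] at this
    exact mul_ne_zero (norm_ne_zero hc.1) (norm_ne_zero hc.2) (by simpa [norm] using this)⟩
  exact NoZeroDivisors.to_isDomain _

lemma isUnit_of_norm {u : CubicInt} (h : norm u = 1 ∨ norm u = -1) : IsUnit u := by
  rcases h with h | h
  · exact IsUnit.of_mul_eq_one (adj u) (by rw [mul_adj, h]; simp)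
  · exact IsUnit.of_mul_eq_one (-adj u) (by rw [mul_neg, mul_adj, h]; simp)

lemma norm_of_isUnit {u : CubicInt} (h : IsUnit u) : norm u = 1 ∨ norm u = -1 := by
  obtain ⟨v, hv⟩ := h.exists_right_inv
  have := congrArg norm hv
  rw [norm_mul] at this
  exact Int.isUnit_iff.mp (IsUnit.of_mul_eq_one _ (by rw [this]; rfl))

lemma prime_two : Prime (2 : CubicInt) := by
  refine ⟨by decide, fun h => ?_, fun u v h => ?_⟩
  · have := norm_of_isUnit h
    revert this; decide
  · obtain ⟨w, hw⟩ := h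
    have h2 : (2 : ℤ) ∣ norm u * norm v := by
      rw [← norm_mul, hw, norm_mul]
      exact Dvd.dvd.mul_right (by decide) _
    rcases Int.prime_two.dvd_or_dvd h2 with h | h
    · exact Or.inl (two_dvd_of_two_dvd_norm h)
    · exact Or.inr (two_dvd_of_two_dvd_norm h)

lemma exists_real_root : ∃ θ : ℝ, θ ^ 3 + θ + 1 = 0 ∧ -0.69 < θ ∧ θ < -0.68 := by
  have hc : ContinuousOn (fun t : ℝ => t ^ 3 + t + 1) (Set.Icc (-0.69) (-0.68)) := by fun_prop
  obtain ⟨θ, hθ, h⟩ := intermediate_value_Ioo (by norm_num) hc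
    (show (0 : ℝ) ∈ Set.Ioo _ _ by constructor <;> norm_num)
  exact ⟨θ, h, hθ.1, hθ.2⟩

/-- The norm form on real triples. -/
def realNorm (x y z : ℝ) : ℝ :=
  x * ((x - z) ^ 2 + y * z + y ^ 2) + z * (x * y + z ^ 2) - y * (y ^ 2 - x * z + z ^ 2)

lemma realNorm_factor {θ : ℝ} (hθ : θ ^ 3 + θ + 1 = 0) (x y z : ℝ) :
    realNorm x y z = (x + y * θ + z * θ ^ 2) *
      (((x - z) ^ 2 + y * z + y ^ 2) - (x * y + z ^ 2) * θ + (y ^ 2 - x * z + z ^ 2) * θ ^ 2) := by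
  unfold realNorm
  linear_combination (-(y * (y ^ 2 - x * z + z ^ 2) - z * (x * y + z ^ 2)) -
    z * (y ^ 2 - x * z + z ^ 2) * θ) * hθ

lemma conj_form_nonneg {θ : ℝ} (hθ : θ ^ 3 + θ + 1 = 0) (x y z : ℝ) :
    0 ≤ ((x - z) ^ 2 + y * z + y ^ 2) - (x * y + z ^ 2) * θ + (y ^ 2 - x * z + z ^ 2) * θ ^ 2 := by
  have : ((x - z) ^ 2 + y * z + y ^ 2) - (x * y + z ^ 2) * θ + (y ^ 2 - x * z + z ^ 2) * θ ^ 2 =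
      ((x - z * (θ ^ 2 + 1)) - θ * (y - z * θ) / 2) ^ 2
        + (1 + 3 * θ ^ 2 / 4) * (y - z * θ) ^ 2 := by
    linear_combination (y * z - z ^ 2 * θ) * hθ
  rw [this]
  positivity

lemma trace_form {θ : ℝ} (hθ : θ ^ 3 + θ + 1 = 0) (x y z : ℝ) :
    (x + y * θ + z * θ ^ 2) ^ 2 +
      2 * (((x - z) ^ 2 + y * z + y ^ 2) - (x * y + z ^ 2) * θ + (y ^ 2 - x * z + z ^ 2) * θ ^ 2) =
    3 * ((x - z) + z / 3) ^ 2 + (3 * θ ^ 2 + 2) * y ^ 2 + (2 / 3 + θ ^ 2 - 3 * θ) * z ^ 2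
      - 2 * θ * y * z := by
  linear_combination (2 * y * z + z ^ 2 * θ) * hθ

lemma abs_realNorm_lt_one {x y z : ℝ} (hx : |x - z + z / 3| ≤ 1 / 2) (hy : |y| ≤ 1 / 2)
    (hz : |z| ≤ 1 / 2) : |realNorm x y z| < 1 := by
  obtain ⟨θ, hθ, h1, h2⟩ := exists_real_root
  rw [realNorm_factor hθ]
  have hT := trace_form hθ x y z
  have hQ := conj_form_nonneg hθ x y z
  set r := x + y * θ + z * θ ^ 2
  set Q := ((x - z) ^ 2 + y * z + y ^ 2) - (x * y + z ^ 2) * θ + (y ^ 2 - x * z + z ^ 2) * θ ^ 2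
  have hx2 := sq_le_sq' (abs_le.mp hx).1 (abs_le.mp hx).2
  have hy2 := sq_le_sq' (abs_le.mp hy).1 (abs_le.mp hy).2
  have hz2 := sq_le_sq' (abs_le.mp hz).1 (abs_le.mp hz).2
  have hyz : -2 * θ * y * z ≤ 0.69 * (y ^ 2 + z ^ 2) := by
    nlinarith [sq_nonneg (y - z), sq_nonneg (y + z)]
  have hθ2 : θ ^ 2 ≤ 0.4761 := by nlinarith
  have hlt : r ^ 2 + 2 * Q < 3 := by
    rw [hT]
    have e1 : (3 * θ ^ 2 + 2) * y ^ 2 ≤ 3.4283 * y ^ 2 := by gcongr; linarith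
    have e2 : (2 / 3 + θ ^ 2 - 3 * θ) * z ^ 2 ≤ 3.2128 * z ^ 2 := by gcongr; linarith
    linarith
  rw [← sq_lt_one_iff_abs_lt_one]
  clear_value r Q
  have h3 : (1 - Q) ^ 2 * (1 + 2 * Q) ≥ 0 := by positivity
  rcases hQ.eq_or_lt with h0 | h0
  · rw [← h0]; norm_num
  · have : Q ^ 2 * (r ^ 2 + 2 * Q) < Q ^ 2 * 3 := by gcongr
    have e1 : (r * Q) ^ 2 = Q ^ 2 * (r ^ 2 + 2 * Q) - 2 * Q ^ 3 := by ring
    have e2 : (1 - Q) ^ 2 * (1 + 2 * Q) = 1 - 3 * Q ^ 2 + 2 * Q ^ 3 := by ring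
    linarith

lemma exists_norm_sub_lt (a : CubicInt) {b : CubicInt} (hb : b ≠ 0) :
    ∃ q, |norm (a - b * q)| < |norm b| := by
  have hn := norm_ne_zero hb
  set n : ℤ := norm b with hn_def
  set u := a * adj b with hu
  have hnR : (n : ℝ) ≠ 0 := by exact_mod_cast hn
  set q2 := round ((u.z : ℝ) / n)
  set q1 := round ((u.y : ℝ) / n)
  set q0 := round ((u.x : ℝ) / n - 2 / 3 * ((u.z : ℝ) / n - q2))
  refine ⟨⟨q0, q1, q2⟩, ?_⟩
  have hlt := abs_realNorm_lt_one (x := (u.x : ℝ) / n - q0) (y := (u.y : ℝ) / n - q1)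
    (z := (u.z : ℝ) / n - q2) (by
      have e : (u.x : ℝ) / n - q0 - ((u.z : ℝ) / n - q2) + ((u.z : ℝ) / n - q2) / 3 =
          (u.x : ℝ) / n - 2 / 3 * ((u.z : ℝ) / n - q2) - q0 := by ring
      rw [e]
      exact abs_sub_round _) (abs_sub_round _) (abs_sub_round _)
  have e1 : ((norm (u - (n : CubicInt) * ⟨q0, q1, q2⟩) : ℤ) : ℝ) = (n : ℝ) ^ 3 *
      realNorm ((u.x : ℝ) / n - q0) ((u.y : ℝ) / n - q1) ((u.z : ℝ) / n - q2) := by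
    simp only [norm, realNorm, sub_x, sub_y, sub_z, mul_x, mul_y, mul_z, intCast_x, intCast_y,
      intCast_z]
    push_cast
    field_simp
    ring
  have e2 : u - (n : CubicInt) * ⟨q0, q1, q2⟩ = (a - b * ⟨q0, q1, q2⟩) * adj b := by
    rw [hu, hn_def, ← mul_adj]; ring
  have e3 : norm (adj b) = n ^ 2 := by
    have := congrArg norm (mul_adj b)
    rw [norm_mul] at this
    have h3 : norm ((norm b : ℤ) : CubicInt) = norm b ^ 3 := by
      simp only [norm, intCast_x, intCast_y, intCast_z]; ring
    rw [h3] at this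
    apply mul_left_cancel₀ hn
    rw [this]; ring
  rw [e2, norm_mul, e3] at e1
  have e4 : ((norm (a - b * ⟨q0, q1, q2⟩) : ℤ) : ℝ) = n *
      realNorm ((u.x : ℝ) / n - q0) ((u.y : ℝ) / n - q1) ((u.z : ℝ) / n - q2) := by
    have : (n : ℝ) ^ 2 ≠ 0 := pow_ne_zero _ hnR
    apply mul_right_cancel₀ this
    push_cast at e1
    rw [e1]; ring
  have e5 : (|norm (a - b * ⟨q0, q1, q2⟩)| : ℝ) < |(n : ℝ)| := by
    rw [e4, abs_mul]
    exact mul_lt_of_lt_one_right (abs_pos.mpr hnR) hlt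
  exact_mod_cast e5

instance : IsPrincipalIdealRing CubicInt := by
  classical
  choose! q hq using fun a b => exists_norm_sub_lt a (b := b)
  let _ : EuclideanDomain CubicInt :=
    { (inferInstance : CommRing CubicInt), (inferInstance : Nontrivial CubicInt) with
      quotient := fun a b => if b = 0 then 0 else q a b
      quotient_zero := fun a => if_pos rfl
      remainder := fun a b => a - b * (if b = 0 then 0 else q a b)
      quotient_mul_add_remainder_eq := fun a b => by ring
      r := fun a b => (norm a).natAbs < (norm b).natAbs
      r_wellFounded := (measure fun a : CubicInt => (norm a).natAbs).wf
      remainder_lt := fun a b hb => by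
        simp only [if_neg hb]
        have := hq a b hb
        rw [Int.abs_eq_natAbs, Int.abs_eq_natAbs] at this
        exact_mod_cast this
      mul_left_not_lt := fun a b hb => by
        rw [norm_mul, Int.natAbs_mul, not_lt]
        exact Nat.le_mul_of_pos_right _ (Int.natAbs_pos.mpr (norm_ne_zero hb)) }
  exact EuclideanDomain.to_principal_ideal_domain

/-- The unit `α`. -/
def αUnit : CubicIntˣ := ⟨α, β, α_mul_β, by decide⟩

lemma small_unit : ∀ X ∈ ([-1, 0, 1] : List ℤ), ∀ y ∈ ([-1, 0, 1] : List ℤ),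
    ∀ z ∈ ([-1, 0, 1] : List ℤ), norm ⟨X + z, y, z⟩ ^ 2 = 1 →
    ∃ ε ∈ [1, -1, α, -α], ∃ t ∈ [1, α, β, α ^ 2, β ^ 2], (⟨X + z, y, z⟩ : CubicInt) = ε * t ^ 2 := by
  decide +kernel

lemma mem_of_abs_le_one {X : ℤ} (h : |X| ≤ 1) : X ∈ ([-1, 0, 1] : List ℤ) := by
  rw [abs_le] at h
  have : X = -1 ∨ X = 0 ∨ X = 1 := by omega
  simpa using this

set_option maxHeartbeats 1000000 in
lemma bounded_unit {θ : ℝ} (hθ : θ ^ 3 + θ + 1 = 0) (h1 : -0.69 < θ) (h2 : θ < -0.68)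
    {u : CubicInt} (hu : IsUnit u) (hl : 1 ≤ |(u.x : ℝ) + u.y * θ + u.z * θ ^ 2|)
    (hr : |(u.x : ℝ) + u.y * θ + u.z * θ ^ 2| * |θ| < 1) :
    ∃ ε ∈ [1, -1, α, -α], ∃ t, u = ε * t ^ 2 := by
  have hN : norm u ^ 2 = 1 := by
    rcases norm_of_isUnit hu with h | h <;> rw [h] <;> rfl
  have hNR : realNorm u.x u.y u.z ^ 2 = 1 := by
    have : ((norm u : ℤ) : ℝ) = realNorm u.x u.y u.z := by
      simp only [norm, realNorm]; push_cast; ring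
    rw [← this]; exact_mod_cast hN
  rw [realNorm_factor hθ] at hNR
  have hT := trace_form hθ u.x u.y u.z
  have hQ := conj_form_nonneg hθ u.x u.y u.z
  set x := (u.x : ℝ)
  set y := (u.y : ℝ)
  set z := (u.z : ℝ)
  set r := x + y * θ + z * θ ^ 2
  set Q := ((x - z) ^ 2 + y * z + y ^ 2) - (x * y + z ^ 2) * θ + (y ^ 2 - x * z + z ^ 2) * θ ^ 2
  have hx : x - z = ((u.x - u.z : ℤ) : ℝ) := by push_cast; rfl
  have hy : y = u.y := rfl
  have hz : z = u.z := rfl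
  clear_value r Q x y z
  have hr1 : 1 ≤ r ^ 2 := by
    rw [← sq_abs]
    exact one_le_pow₀ hl
  have hQ1 : Q ≤ 1 := by
    have : 1 * Q ^ 2 ≤ r ^ 2 * Q ^ 2 := by gcongr
    rw [mul_pow] at hNR
    exact (abs_le.mp ((sq_le_one_iff_abs_le_one Q).mp (by linarith))).2
  have hr2 : r ^ 2 * θ ^ 2 < 1 := by
    rw [← mul_pow, ← sq_abs, abs_mul]
    exact pow_lt_one₀ (by positivity) hr two_ne_zero
  have hθ2 : 0.4624 ≤ θ ^ 2 := by nlinarith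
  have hθ2' : θ ^ 2 ≤ 0.4761 := by nlinarith
  have hr3 : r ^ 2 ≤ 2.17 := by
    by_contra! h
    nlinarith
  have hyz : |-2 * θ * y * z| ≤ 0.69 * (y ^ 2 + z ^ 2) := by
    rw [abs_le]
    constructor <;> nlinarith [sq_nonneg (y - z), sq_nonneg (y + z)]
  have hyz' := (abs_le.mp hyz).1
  have e1 : 3.3872 * y ^ 2 ≤ (3 * θ ^ 2 + 2) * y ^ 2 := by gcongr; linarith
  have e2 : 3.169 * z ^ 2 ≤ (2 / 3 + θ ^ 2 - 3 * θ) * z ^ 2 := by gcongr; linarith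
  have hx' := sq_nonneg ((x - z) + z / 3)
  have by2 : y ^ 2 < 4 := by nlinarith [sq_nonneg z]
  have bz2 : z ^ 2 < 4 := by nlinarith [sq_nonneg y]
  have intb : ∀ t : ℤ, (t : ℝ) ^ 2 < 4 → |t| ≤ 1 := by
    intro t ht
    have : t ^ 2 < 4 := by exact_mod_cast ht
    rw [abs_le]
    constructor <;> nlinarith
  have hz1 := intb _ (hz ▸ bz2)
  have bX2 : (x - z) ^ 2 < 4 := by
    have hz2 : z ^ 2 ≤ 1 := by
      have : u.z ^ 2 ≤ 1 := by
        rw [← sq_abs]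
        have := abs_nonneg u.z
        nlinarith
      rw [hz]; exact_mod_cast this
    have : 3 * ((x - z) + z / 3) ^ 2 ≤ 4.17 := by nlinarith [sq_nonneg z, sq_nonneg y]
    nlinarith [sq_nonneg ((x - z) - z), sq_nonneg ((x - z) + z), sq_nonneg (x - z)]
  have hX1 := intb (u.x - u.z) (hx ▸ bX2)
  obtain ⟨ε, hε, t, -, h⟩ := small_unit (u.x - u.z) (mem_of_abs_le_one hX1) u.y
    (mem_of_abs_le_one (intb _ (hy ▸ by2))) u.z (mem_of_abs_le_one hz1) (by simpa using hN)
  exact ⟨ε, hε, t, by simpa using h⟩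

/-- The ring homomorphism to `ℝ` sending `α` to a real root. -/
def toReal {θ : ℝ} (hθ : θ ^ 3 + θ + 1 = 0) : CubicInt →+* ℝ where
  toFun u := u.x + u.y * θ + u.z * θ ^ 2
  map_one' := by simp
  map_zero' := by simp
  map_add' u v := by simp; ring
  map_mul' u v := by
    simp only [mul_x, mul_y, mul_z]
    push_cast
    linear_combination (-(u.y * v.z + u.z * v.y : ℝ) - u.z * v.z * θ) * hθ

/-- Representatives of the units modulo squares. -/
def unitReps : List CubicInt := [1, -1, α, -α]

lemma exists_unit_eq {u : CubicInt} (hu : IsUnit u) :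
    ∃ ε ∈ unitReps, ∃ τ, IsUnit τ ∧ u = ε * τ ^ 2 := by
  suffices h : ∃ ε ∈ unitReps, ∃ τ, u = ε * τ ^ 2 by
    obtain ⟨ε, hε, τ, h⟩ := h
    refine ⟨ε, hε, τ, ?_, h⟩
    rw [h, sq, ← mul_assoc] at hu
    exact isUnit_of_mul_isUnit_right hu
  obtain ⟨θ, hθ, h1, h2⟩ := exists_real_root
  obtain ⟨U, rfl⟩ := hu
  set f := toReal hθ
  have hfα : f α = θ := by simp [f, toReal]
  have h0 : f U ≠ 0 := (U.isUnit.map f).ne_zero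
  have hθ0 : 0 < |θ| := abs_pos.mpr (by linarith)
  have hθ1 : |θ| < 1 := by rw [abs_lt]; constructor <;> linarith
  obtain ⟨n, hn1, hn2⟩ := exists_mem_Ico_zpow (abs_pos.mpr h0)
    ((one_lt_inv₀ hθ0).mpr hθ1)
  have hv : f ((U * αUnit ^ n : CubicIntˣ) : CubicInt) = f U * θ ^ n := by
    have := (Units.map (f : CubicInt →* ℝ)).map_zpow αUnit n
    have h3 := congrArg Units.val this
    rw [Units.val_zpow_eq_zpow_val] at h3
    simp only [Units.coe_map, MonoidHom.coe_coe] at h3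
    rw [Units.val_mul, map_mul, h3]
    congr 2
  have hpos : 0 < |θ| ^ n := zpow_pos hθ0 n
  obtain ⟨ε, hε, t, ht⟩ := bounded_unit hθ h1 h2 (U * αUnit ^ n).isUnit
    (by
      change 1 ≤ |f _|
      rw [hv, abs_mul, abs_zpow]
      rw [inv_zpow] at hn1
      calc (1 : ℝ) = (|θ| ^ n)⁻¹ * |θ| ^ n := by field_simp
        _ ≤ _ := by gcongr)
    (by
      change |f _| * _ < 1
      rw [hv, abs_mul, abs_zpow]
      rw [inv_zpow, zpow_add_one₀ hθ0.ne'] at hn2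
      calc _ < (|θ| ^ n * |θ|)⁻¹ * |θ| ^ n * |θ| := by gcongr
        _ = 1 := by field_simp)
  have hU : (U : CubicInt) = ε * t ^ 2 * ((αUnit ^ (-n) : CubicIntˣ) : CubicInt) := by
    rw [← ht, ← Units.val_mul, mul_assoc, ← zpow_add]; simp
  have hsq : ∀ ε ∈ unitReps, ∃ ε' ∈ unitReps, ∃ s, ε * α = ε' * s ^ 2 := by
    unfold unitReps
    intro ε hε
    fin_cases hε
    · exact ⟨α, by simp, 1, by ring⟩
    · exact ⟨-α, by simp, 1, by ring⟩
    · exact ⟨1, by simp, α, by ring⟩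
    · exact ⟨-1, by simp, α, by ring⟩
  rcases Int.even_or_odd' (-n) with ⟨m, hm | hm⟩
  · refine ⟨ε, hε, t * ((αUnit ^ m : CubicIntˣ) : CubicInt), ?_⟩
    rw [hU, hm, two_mul, zpow_add, Units.val_mul]; ring
  · obtain ⟨ε', hε', s, hs⟩ := hsq ε hε
    refine ⟨ε', hε', t * s * ((αUnit ^ m : CubicIntˣ) : CubicInt), ?_⟩
    rw [hU, hm, two_mul, zpow_add, zpow_add, Units.val_mul, Units.val_mul, zpow_one]
    change ε * t ^ 2 * (_ * α) = _
    linear_combination (t ^ 2 * ((αUnit ^ m : CubicIntˣ) : CubicInt) ^ 2) * hs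

/-- Unit representatives paired with their inverses. -/
def unitPairs : List (CubicInt × CubicInt) := [(1, 1), (-1, -1), (α, β), (-α, -β)]

lemma mul_of_mem_unitPairs {ε ε' : CubicInt} (h : (ε, ε') ∈ unitPairs) : ε * ε' = 1 := by
  unfold unitPairs at h
  simp only [List.mem_cons, Prod.mk.injEq, List.not_mem_nil, or_false] at h
  rcases h with ⟨rfl, rfl⟩ | ⟨rfl, rfl⟩ | ⟨rfl, rfl⟩ | ⟨rfl, rfl⟩
  · simp
  · simp
  · exact α_mul_β
  · simpa using α_mul_β

lemma exists_unitPairs {ε : CubicInt} (h : ε ∈ unitReps) : ∃ ε', (ε, ε') ∈ unitPairs := by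
  unfold unitReps at h
  unfold unitPairs
  fin_cases h
  exacts [⟨1, by simp⟩, ⟨-1, by simp⟩, ⟨β, by simp⟩, ⟨-β, by simp⟩]

/-- Factors of a fourth power up to a unit. -/
lemma exists_fourth_powers {M N u g : CubicInt} (hc : IsCoprime M N) (hu : IsUnit u) (hg : g ≠ 0)
    (h : M * N = u * g ^ 4) :
    ∃ ε ε' τ m n : CubicInt, (ε, ε') ∈ unitPairs ∧ IsUnit τ ∧ τ ^ 2 * M = ε * m ^ 4 ∧
      τ ^ 2 * N = u * ε' * n ^ 4 ∧ m * n = τ * g := by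
  obtain ⟨U, hU⟩ := hu.exists_right_inv
  have hUu : IsUnit U := IsUnit.of_mul_eq_one u (by rw [mul_comm]; exact hU)
  have hc' : IsCoprime M (U * N) := (isCoprime_mul_unit_left_right hUu M N).mpr hc
  obtain ⟨d, hd⟩ := exists_associated_pow_of_mul_eq_pow' hc'
    (show M * (U * N) = g ^ 4 by linear_combination U * h + g ^ 4 * hU)
  obtain ⟨v, hv⟩ := hd
  obtain ⟨ε, hε, τ, hτ, hvε⟩ := exists_unit_eq v.isUnit
  obtain ⟨ε', hp⟩ := exists_unitPairs hε
  have hεε := mul_of_mem_unitPairs hp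
  obtain ⟨σ, hσ⟩ := hτ.exists_right_inv
  rw [hvε] at hv
  have hM0 : M ≠ 0 := by
    rintro rfl
    rw [zero_mul, eq_comm, mul_eq_zero] at h
    rcases h with h | h
    · exact hu.ne_zero h
    · exact hg (pow_eq_zero_iff (by norm_num) |>.mp h)
  have hd0 : d ≠ 0 := by
    rintro rfl
    apply hM0; rw [← hv]; ring
  have hdg : d ∣ g := by
    rw [← IsIntegrallyClosed.pow_dvd_pow_iff (n := 4) (by norm_num)]
    refine ⟨ε * τ ^ 2 * (U * N), ?_⟩
    linear_combination -U * h - g ^ 4 * hU - (U * N) * hv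
  obtain ⟨k, hk⟩ := hdg
  have hUN : ε * τ ^ 2 * N = u * k ^ 4 := by
    have : d ^ 4 ≠ 0 := pow_ne_zero _ hd0
    apply mul_left_cancel₀ this
    rw [hk] at h
    linear_combination h + N * hv
  refine ⟨ε, ε', σ, d, σ * k, hp, IsUnit.of_mul_eq_one τ (by rw [mul_comm]; exact hσ), ?_, ?_, ?_⟩
  · linear_combination -σ ^ 2 * hv + d ^ 4 * ε * (τ * σ + 1) * hσ
  · linear_combination σ ^ 4 * ε' * hUN - σ ^ 4 * τ ^ 2 * N * hεε
      - σ ^ 2 * N * (τ * σ + 1) * hσ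
  · rw [hk]; ring

instance decidableOfNatDvd (n : ℕ) [n.AtLeastTwo] (u : CubicInt) :
    Decidable ((ofNat(n) : CubicInt) ∣ u) :=
  decidable_of_iff ((n : ℤ) ∣ u.x ∧ (n : ℤ) ∣ u.y ∧ (n : ℤ) ∣ u.z) (dvd_iff n u).symm

/-- The elements with coordinates in a given list. -/
def box (l : List ℤ) : List CubicInt :=
  l.flatMap fun x => l.flatMap fun y => l.map fun z => ⟨x, y, z⟩

lemma mem_box {l : List ℤ} {x y z : ℤ} (hx : x ∈ l) (hy : y ∈ l) (hz : z ∈ l) :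
    (⟨x, y, z⟩ : CubicInt) ∈ box l := by
  simp only [box, List.mem_flatMap, List.mem_map]
  exact ⟨x, hx, y, hy, z, hz, rfl⟩

lemma exists_rep_two (u : CubicInt) : ∃ r ∈ box [0, 1], ∃ k, u = r + 2 * k := by
  have h : ∀ t : ℤ, t % 2 ∈ ([0, 1] : List ℤ) := by
    intro t
    have : t % 2 = 0 ∨ t % 2 = 1 := by omega
    simpa using this
  refine ⟨⟨u.x % 2, u.y % 2, u.z % 2⟩, mem_box (h _) (h _) (h _), ⟨u.x / 2, u.y / 2, u.z / 2⟩, ?_⟩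
  ext <;> simp <;> omega

lemma exists_rep_four (u : CubicInt) : ∃ r ∈ box [0, 1, 2, 3], ∃ k, u = r + 4 * k := by
  have h : ∀ t : ℤ, t % 4 ∈ ([0, 1, 2, 3] : List ℤ) := by
    intro t
    have : t % 4 = 0 ∨ t % 4 = 1 ∨ t % 4 = 2 ∨ t % 4 = 3 := by omega
    simpa using this
  refine ⟨⟨u.x % 4, u.y % 4, u.z % 4⟩, mem_box (h _) (h _) (h _), ⟨u.x / 4, u.y / 4, u.z / 4⟩, ?_⟩
  ext <;> simp <;> omega

/-- The local conditions at `2` used in the descent on `w² = 1 + a z² + b z⁴`. -/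
structure Descent (a b ζ : CubicInt) : Prop where
  isUnit_b : IsUnit b
  prime_disc : Prime (a ^ 2 - 4 * b)
  unit_of_disc : ∀ {f Q ε ε' : CubicInt}, (ε, ε') ∈ unitPairs → ¬ 2 ∣ f →
    4 ∣ Q ^ 2 - ε' * (a ^ 2 - 4 * b) * f ^ 4 → ε' = 1
  no_odd : ∀ {m n δ δ' : CubicInt}, (δ, δ') ∈ unitPairs → ¬ 2 ∣ m → ¬ 2 ∣ n →
    ¬ 4 ∣ δ * m ^ 4 + a * m ^ 2 * n ^ 2 + b * δ' * n ^ 4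
  base : ∀ {e f Q ε ε' : CubicInt}, (ε, ε') ∈ unitPairs → ¬ 2 ∣ e → ¬ 2 ∣ f → ¬ 2 ∣ Q →
    8 ∣ Q ^ 2 - (ε * e ^ 4 - 2 * a * e ^ 2 * f ^ 2 + ε' * (a ^ 2 - 4 * b) * f ^ 4) →
    2 ∣ e * f - ζ * Q

lemma unit_of_sq_table : ∀ p ∈ unitPairs, ∀ e ∈ box [0, 1], ∀ q ∈ box [0, 1], ¬ 2 ∣ e →
    4 ∣ q ^ 2 - p.1 * e ^ 4 → p.1 = 1 := by
  decide +kernel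

lemma not_two_dvd_of_add {r k : CubicInt} (h : ¬ 2 ∣ r + 2 * k) : ¬ 2 ∣ r := by
  contrapose h
  exact dvd_add h (dvd_mul_right _ _)

lemma unit_of_sq {e Q ε ε' : CubicInt} (hp : (ε, ε') ∈ unitPairs) (he : ¬ 2 ∣ e)
    (h : 4 ∣ Q ^ 2 - ε * e ^ 4) : ε = 1 := by
  obtain ⟨e, he0, k, rfl⟩ := exists_rep_two e
  obtain ⟨Q, hQ0, l, rfl⟩ := exists_rep_two Q
  refine unit_of_sq_table _ hp e he0 Q hQ0 (not_two_dvd_of_add he) ?_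
  have e1 : Q ^ 2 - ε * e ^ 4 = ((Q + 2 * l) ^ 2 - ε * (e + 2 * k) ^ 4) + 4 * (-(Q * l + l ^ 2) +
      ε * (2 * e ^ 3 * k + 6 * e ^ 2 * k ^ 2 + 8 * e * k ^ 3 + 4 * k ^ 4)) := by ring
  rw [e1]
  exact dvd_add h (dvd_mul_right _ _)

/-- The finite check behind `Descent`. -/
def Table (a b ζ : CubicInt) : Prop :=
  (∀ p ∈ unitPairs, ∀ f ∈ box [0, 1], ∀ q ∈ box [0, 1], ¬ 2 ∣ f →
    4 ∣ q ^ 2 - p.2 * (a ^ 2 - 4 * b) * f ^ 4 → p.2 = 1) ∧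
  (∀ p ∈ unitPairs, ∀ m ∈ box [0, 1], ¬ 2 ∣ m → ∀ n ∈ box [0, 1], ¬ 2 ∣ n →
    ¬ 4 ∣ p.1 * m ^ 4 + a * m ^ 2 * n ^ 2 + b * p.2 * n ^ 4) ∧
  (∀ p ∈ unitPairs, ∀ e ∈ box [0, 1], ¬ 2 ∣ e → ∀ f ∈ box [0, 1], ¬ 2 ∣ f →
    ∀ q ∈ box [0, 1, 2, 3], ¬ 2 ∣ q →
    8 ∣ q ^ 2 - (p.1 * e ^ 4 - 2 * a * e ^ 2 * f ^ 2 + p.2 * (a ^ 2 - 4 * b) * f ^ 4) →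
    2 ∣ e * f - ζ * q)

instance (a b ζ : CubicInt) : Decidable (Table a b ζ) := by
  unfold Table; infer_instance

lemma Descent.of_table {a b ζ : CubicInt} (hb : IsUnit b) (hD : Prime (a ^ 2 - 4 * b))
    (h : Table a b ζ) : Descent a b ζ where
  isUnit_b := hb
  prime_disc := hD
  unit_of_disc := by
    intro f Q ε ε' hp hf hd
    obtain ⟨f, hf0, k, rfl⟩ := exists_rep_two f
    obtain ⟨Q, hQ0, l, rfl⟩ := exists_rep_two Q
    refine h.1 _ hp f hf0 Q hQ0 (not_two_dvd_of_add hf) ?_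
    have e1 : Q ^ 2 - ε' * (a ^ 2 - 4 * b) * f ^ 4 =
        ((Q + 2 * l) ^ 2 - ε' * (a ^ 2 - 4 * b) * (f + 2 * k) ^ 4) + 4 * (-(Q * l + l ^ 2) +
        ε' * (a ^ 2 - 4 * b) * (2 * f ^ 3 * k + 6 * f ^ 2 * k ^ 2 + 8 * f * k ^ 3 + 4 * k ^ 4)) := by
      ring
    rw [e1]
    exact dvd_add hd (dvd_mul_right _ _)
  no_odd := by
    intro m n δ δ' hp hm hn hd
    obtain ⟨m, hm0, k, rfl⟩ := exists_rep_two m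
    obtain ⟨n, hn0, l, rfl⟩ := exists_rep_two n
    refine h.2.1 _ hp m hm0 (not_two_dvd_of_add hm) n hn0 (not_two_dvd_of_add hn) ?_
    have e1 : δ * m ^ 4 + a * m ^ 2 * n ^ 2 + b * δ' * n ^ 4 =
        (δ * (m + 2 * k) ^ 4 + a * (m + 2 * k) ^ 2 * (n + 2 * l) ^ 2 + b * δ' * (n + 2 * l) ^ 4)
        + 4 * (-δ * (2 * m ^ 3 * k + 6 * m ^ 2 * k ^ 2 + 8 * m * k ^ 3 + 4 * k ^ 4)
          - b * δ' * (2 * n ^ 3 * l + 6 * n ^ 2 * l ^ 2 + 8 * n * l ^ 3 + 4 * l ^ 4)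
          - a * ((m * k + k ^ 2) * n ^ 2 + m ^ 2 * (n * l + l ^ 2)
            + 4 * (m * k + k ^ 2) * (n * l + l ^ 2))) := by
      ring
    rw [e1]
    exact dvd_add hd (dvd_mul_right _ _)
  base := by
    intro e f Q ε ε' hp he hf hQ hd
    obtain ⟨e, he0, k, rfl⟩ := exists_rep_two e
    obtain ⟨f, hf0, l, rfl⟩ := exists_rep_two f
    obtain ⟨Q, hQ0, j, rfl⟩ := exists_rep_four Q
    have h2 : 2 ∣ e * f - ζ * Q := by
      refine h.2.2 _ hp e he0 (not_two_dvd_of_add he) f hf0 (not_two_dvd_of_add hf) Q hQ0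
        (not_two_dvd_of_add (k := 2 * j) (by rwa [show Q + 2 * (2 * j) = Q + 4 * j by ring])) ?_
      have e1 : Q ^ 2 - (ε * e ^ 4 - 2 * a * e ^ 2 * f ^ 2 + ε' * (a ^ 2 - 4 * b) * f ^ 4) =
          ((Q + 4 * j) ^ 2 - (ε * (e + 2 * k) ^ 4 - 2 * a * (e + 2 * k) ^ 2 * (f + 2 * l) ^ 2
            + ε' * (a ^ 2 - 4 * b) * (f + 2 * l) ^ 4))
          + 8 * (-(Q * j + 2 * j ^ 2) + ε * (e ^ 3 * k + 3 * e ^ 2 * k ^ 2 + 4 * e * k ^ 3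
            + 2 * k ^ 4) + ε' * (a ^ 2 - 4 * b) * (f ^ 3 * l + 3 * f ^ 2 * l ^ 2 + 4 * f * l ^ 3
            + 2 * l ^ 4) - a * ((e * k + k ^ 2) * f ^ 2 + e ^ 2 * (f * l + l ^ 2)
            + 4 * (e * k + k ^ 2) * (f * l + l ^ 2))) := by
        ring
      rw [e1]
      exact dvd_add hd (dvd_mul_right _ _)
    have e2 : (e + 2 * k) * (f + 2 * l) - ζ * (Q + 4 * j) =
        (e * f - ζ * Q) + 2 * (e * l + k * f + 2 * k * l - 2 * ζ * j) := by ring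
    rw [e2]
    exact dvd_add h2 (dvd_mul_right _ _)

lemma prime_of_norm {u : CubicInt} (h : (norm u).natAbs.Prime) : Prime u := by
  apply Irreducible.prime
  refine ⟨fun hu => ?_, fun v w hvw => ?_⟩
  · rcases norm_of_isUnit hu with h1 | h1 <;> rw [h1] at h <;> exact Nat.not_prime_one h
  · rw [hvw, norm_mul, Int.natAbs_mul, Nat.prime_mul_iff] at h
    rcases h with ⟨-, h⟩ | ⟨-, h⟩
    · exact Or.inr (isUnit_of_norm (by omega))
    · exact Or.inl (isUnit_of_norm (by omega))

lemma descent_first : Descent α (-β) 1 :=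
  .of_table αUnit⁻¹.isUnit.neg (prime_of_norm (by rw [show norm (α ^ 2 - 4 * -β) = -31 by decide]; norm_num))
    (by decide +kernel)

lemma descent_second : Descent (-α ^ 2) (-α) (1 + α) :=
  .of_table αUnit.isUnit.neg (prime_of_norm (by rw [show norm ((-α ^ 2) ^ 2 - 4 * -α) = -31 by decide]; norm_num))
    (by decide +kernel)

lemma exists_coprime_fourth_powers {M N u g : CubicInt} (hc : IsCoprime M N) (hu : IsUnit u)
    (hg : g ≠ 0) (h : M * N = u * g ^ 4) :
    ∃ ε ε' τ m n : CubicInt, (ε, ε') ∈ unitPairs ∧ IsUnit τ ∧ τ ^ 2 * M = ε * m ^ 4 ∧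
      τ ^ 2 * N = u * ε' * n ^ 4 ∧ m * n = τ * g ∧ IsCoprime m n := by
  obtain ⟨ε, ε', τ, m, n, hp, hτ, hM, hN, hmn⟩ := exists_fourth_powers hc hu hg h
  refine ⟨ε, ε', τ, m, n, hp, hτ, hM, hN, hmn, ?_⟩
  have h1 : IsCoprime (τ ^ 2 * M) (τ ^ 2 * N) :=
    (isCoprime_mul_unit_left (hτ.pow 2) M N).mpr hc
  rw [hM, hN] at h1
  exact (h1.of_isCoprime_of_dvd_left ((dvd_pow_self m four_ne_zero).mul_left ε)).of_isCoprime_of_dvd_right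
    ((dvd_pow_self n four_ne_zero).mul_left _)

lemma not_two_dvd_mul {u v : CubicInt} (hu : ¬ 2 ∣ u) (hv : ¬ 2 ∣ v) : ¬ 2 ∣ u * v :=
  fun h => (prime_two.dvd_or_dvd h).elim hu hv

lemma not_two_dvd_of_isUnit {u : CubicInt} (hu : IsUnit u) : ¬ 2 ∣ u :=
  fun h => prime_two.not_isUnit (isUnit_of_dvd_unit h hu)

lemma exists_eq_add_two_mul {U V c : CubicInt} (h : U ^ 2 - V ^ 2 = 2 * c) : ∃ k, U = V + 2 * k := by
  have h2 : (2 : CubicInt) ∣ (U - V) * (U + V) := ⟨c, by linear_combination h⟩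
  rcases prime_two.dvd_or_dvd h2 with ⟨k, hk⟩ | ⟨k, hk⟩
  · exact ⟨k, by linear_combination hk⟩
  · exact ⟨k - V, by linear_combination hk⟩

lemma not_dvd_both {π p q : CubicInt} (hπ : Prime π) (hc : IsCoprime p q) (h : π ∣ p) : ¬ π ∣ q :=
  fun h' => hπ.not_isUnit (hc.isUnit_of_dvd' h h')

variable {a b ζ : CubicInt}

lemma Descent.first_step (h : Descent a b ζ) {p q W : CubicInt} (hc : IsCoprime p q) (hp : p ≠ 0)
    (hW : W ^ 2 = q ^ 4 + 4 * a * p ^ 2 * q ^ 2 + 16 * b * p ^ 4) :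
    ∃ ε ε' τ e f : CubicInt, (ε, ε') ∈ unitPairs ∧ IsUnit τ ∧ e * f = τ * p ∧ IsCoprime e f ∧
      (τ * q) ^ 2 = ε * e ^ 4 - 2 * a * e ^ 2 * f ^ 2 + ε' * (a ^ 2 - 4 * b) * f ^ 4 := by
  obtain ⟨c, rfl⟩ := exists_eq_add_two_mul (U := W) (V := q ^ 2)
    (c := 2 * a * p ^ 2 * q ^ 2 + 8 * b * p ^ 4) (by linear_combination hW)
  have hc2 : c ^ 2 + c * q ^ 2 = a * p ^ 2 * q ^ 2 + 4 * b * p ^ 4 := by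
    have h4 : (4 : CubicInt) ≠ 0 := by decide
    apply mul_left_cancel₀ h4
    linear_combination hW
  obtain ⟨M, hM⟩ : ∃ M, M = c + q ^ 2 + a * p ^ 2 := ⟨_, rfl⟩
  obtain ⟨N, hN⟩ : ∃ N, N = c - a * p ^ 2 := ⟨_, rfl⟩
  have hMN : M * N = -(a ^ 2 - 4 * b) * p ^ 4 := by
    rw [hM, hN]; linear_combination hc2
  have hsub : M - N = q ^ 2 + 2 * a * p ^ 2 := by rw [hM, hN]; ring
  have hD := h.prime_disc
  have hcop : IsCoprime M N := by
    refine isCoprime_of_prime_dvd ?_ fun π hπ hπM hπN => ?_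
    · rintro ⟨rfl, rfl⟩
      rw [zero_mul, eq_comm, mul_eq_zero, neg_eq_zero] at hMN
      rcases hMN with h0 | h0
      · exact hD.ne_zero h0
      · exact hp (pow_eq_zero_iff (by norm_num) |>.mp h0)
    have hπp : ¬ π ∣ p := by
      intro h1
      apply not_dvd_both hπ hc h1
      apply hπ.dvd_of_dvd_pow (n := 2)
      rw [show q ^ 2 = (M - N) - 2 * a * p * p by rw [hsub]; ring]
      exact dvd_sub (dvd_sub hπM hπN) (h1.mul_left _)
    have h2 : π ^ 2 ∣ (a ^ 2 - 4 * b) * p ^ 4 := by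
      rw [sq, show (a ^ 2 - 4 * b) * p ^ 4 = -(M * N) by rw [hMN]; ring]
      exact (mul_dvd_mul hπM hπN).neg_right
    have h3 := hπ.pow_dvd_of_dvd_mul_right 2 (fun h4 => hπp (hπ.dvd_of_dvd_pow h4)) h2
    rw [sq] at h3
    exact hπ.not_isUnit (hD.irreducible.squarefree π h3)
  have hdiv : a ^ 2 - 4 * b ∣ M ∨ a ^ 2 - 4 * b ∣ N :=
    hD.dvd_or_dvd (hMN ▸ (dvd_neg.mpr dvd_rfl).mul_right _)
  have key : ∀ K L : CubicInt, IsCoprime K L → K * L = 1 * p ^ 4 →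
      K + (a ^ 2 - 4 * b) * L = q ^ 2 + 2 * a * p ^ 2 →
      ∃ ε ε' τ e f : CubicInt, (ε, ε') ∈ unitPairs ∧ IsUnit τ ∧ e * f = τ * p ∧ IsCoprime e f ∧
      (τ * q) ^ 2 = ε * e ^ 4 - 2 * a * e ^ 2 * f ^ 2 + ε' * (a ^ 2 - 4 * b) * f ^ 4 := by
    intro K L hKL hprod hsum
    obtain ⟨ε, ε', τ, m, n, hpair, hτ, hK, hL, hmn, hcmn⟩ :=
      exists_coprime_fourth_powers hKL isUnit_one hp hprod
    refine ⟨ε, ε', τ, m, n, hpair, hτ, hmn, hcmn, ?_⟩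
    linear_combination hK + (a ^ 2 - 4 * b) * hL - τ ^ 2 * hsum + 2 * a * (m * n + τ * p) * hmn
  have hD0 := hD.ne_zero
  rcases hdiv with ⟨L, hL⟩ | ⟨L, hL⟩
  · refine key (-N) L ?_ ?_ (by linear_combination hsub - hL)
    · rw [hL] at hcop
      exact (IsCoprime.of_mul_left_right hcop).symm.neg_left
    · apply mul_left_cancel₀ hD0
      rw [hL] at hMN
      linear_combination -hMN
  · refine key M (-L) ?_ ?_ (by linear_combination hsub + hL)
    · rw [hL] at hcop
      exact (IsCoprime.of_mul_right_right hcop).neg_right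
    · apply mul_left_cancel₀ hD0
      rw [hL] at hMN
      linear_combination -hMN

lemma Descent.base_step (h : Descent a b ζ) {p q W : CubicInt} (hc : IsCoprime p q) (hp : ¬ 2 ∣ p)
    (hq : ¬ 2 ∣ q) (hW : W ^ 2 = q ^ 4 + 4 * a * p ^ 2 * q ^ 2 + 16 * b * p ^ 4) :
    2 ∣ p - ζ * q := by
  obtain ⟨ε, ε', τ, e, f, hpair, hτ, hef, -, hQ⟩ :=
    h.first_step hc (fun h0 => hp (h0 ▸ dvd_zero _)) hW
  have h2 : ¬ 2 ∣ e * f := hef ▸ not_two_dvd_mul (not_two_dvd_of_isUnit hτ) hp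
  have h3 := h.base hpair (fun h1 => h2 (h1.mul_right _)) (fun h1 => h2 (h1.mul_left _))
    (not_two_dvd_mul (not_two_dvd_of_isUnit hτ) hq) (by rw [hQ, sub_self]; exact dvd_zero _)
  rw [hef, show τ * p - ζ * (τ * q) = τ * (p - ζ * q) by ring] at h3
  exact (prime_two.dvd_or_dvd h3).resolve_left (not_two_dvd_of_isUnit hτ)

lemma Descent.second_step (h : Descent a b ζ) {e f M N : CubicInt} (hf : f ≠ 0)
    (hc : IsCoprime M N) (hMN : M * N = b * f ^ 4) (hs : M + N = e ^ 2 - a * f ^ 2)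
    (hM : ¬ 2 ∣ M) :
    ∃ δ δ' σ m n : CubicInt, (δ, δ') ∈ unitPairs ∧ IsUnit σ ∧ σ ^ 2 * M = δ * m ^ 4 ∧
      σ ^ 2 * N = b * δ' * n ^ 4 ∧ m * n = σ * f ∧ ¬ 2 ∣ m ∧
      (σ * e) ^ 2 = δ * m ^ 4 + a * m ^ 2 * n ^ 2 + b * δ' * n ^ 4 := by
  obtain ⟨δ, δ', σ, m, n, hpair, hσ, h1, h2, hmn, -⟩ :=
    exists_coprime_fourth_powers hc h.isUnit_b hf hMN
  refine ⟨δ, δ', σ, m, n, hpair, hσ, h1, h2, hmn, ?_, ?_⟩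
  · intro hm
    apply not_two_dvd_mul (not_two_dvd_of_isUnit (hσ.pow 2)) hM
    rw [h1]
    exact (dvd_pow hm four_ne_zero).mul_left _
  · linear_combination h1 + h2 - σ ^ 2 * hs - a * (m * n + σ * f) * hmn

lemma Descent.factor (h : Descent a b ζ) {e f Q : CubicInt} (hf : f ≠ 0)
    (hc : IsCoprime e f) (hQ : Q ^ 2 = e ^ 4 - 2 * a * e ^ 2 * f ^ 2 + (a ^ 2 - 4 * b) * f ^ 4) :
    ∃ M, IsCoprime M (M + Q) ∧ M * (M + Q) = b * f ^ 4 ∧ M + (M + Q) = e ^ 2 - a * f ^ 2 := by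
  obtain ⟨M, hM⟩ := exists_eq_add_two_mul (U := e ^ 2 - a * f ^ 2) (V := Q)
    (c := 2 * b * f ^ 4) (by linear_combination -hQ)
  have h4 : (4 : CubicInt) ≠ 0 := by decide
  have hprod : M * (M + Q) = b * f ^ 4 := by
    apply mul_left_cancel₀ h4
    linear_combination -hQ - (e ^ 2 - a * f ^ 2 + Q + 2 * M) * hM
  refine ⟨M, ?_, hprod, by linear_combination -hM⟩
  refine isCoprime_of_prime_dvd ?_ fun π hπ hπM hπN => ?_
  · rintro ⟨h0, -⟩
    rw [h0, zero_mul, eq_comm, mul_eq_zero] at hprod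
    rcases hprod with h1 | h1
    · exact h.isUnit_b.ne_zero h1
    · exact hf (pow_eq_zero_iff (by norm_num) |>.mp h1)
  have hπf : π ∣ f := by
    have h1 : π ∣ b * f ^ 4 := hprod ▸ hπM.mul_right _
    rcases hπ.dvd_or_dvd h1 with h2 | h2
    · exact absurd (isUnit_of_dvd_unit h2 h.isUnit_b) hπ.not_isUnit
    · exact hπ.dvd_of_dvd_pow h2
  apply not_dvd_both hπ hc.symm hπf
  apply hπ.dvd_of_dvd_pow (n := 2)
  rw [show e ^ 2 = M + (M + Q) + a * f * f by linear_combination hM]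
  exact dvd_add (dvd_add hπM hπN) (hπf.mul_left _)

lemma Descent.halving (h : Descent a b ζ) {p q W : CubicInt} (hc : IsCoprime p q) (hp : p ≠ 0)
    (hp2 : 2 ∣ p) (hq : ¬ 2 ∣ q)
    (hW : W ^ 2 = q ^ 4 + 4 * a * p ^ 2 * q ^ 2 + 16 * b * p ^ 4) :
    ∃ m n E s : CubicInt, ¬ 2 ∣ m ∧ 2 ∣ n ∧ E ^ 2 = m ^ 4 + a * m ^ 2 * n ^ 2 + b * n ^ 4 ∧
      s ^ 2 = 1 ∧ p * (m ^ 4 - b * n ^ 4) = s * (n * m * E * q) := by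
  obtain ⟨ε, ε', τ, e, f, hpair, hτ, hef, hcef, hQ⟩ := h.first_step hc hp hW
  have hτ2 := not_two_dvd_of_isUnit hτ
  have hQodd := not_two_dvd_mul hτ2 hq
  have hf0 : f ≠ 0 := by
    rintro rfl
    rw [mul_zero, eq_comm, mul_eq_zero] at hef
    exact hef.elim hτ.ne_zero hp
  have h2ef : 2 ∣ e * f := hef ▸ hp2.mul_left τ
  have hεε := mul_of_mem_unitPairs hpair
  have hε : ε = 1 := by
    rcases prime_two.dvd_or_dvd h2ef with h2 | h2
    · have hf := not_dvd_both prime_two hcef h2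
      have := h.unit_of_disc hpair hf (Q := τ * q) (by
        obtain ⟨k, rfl⟩ := h2
        rw [hQ]
        exact ⟨4 * ε * k ^ 4 - 2 * a * k ^ 2 * f ^ 2, by ring⟩)
      rwa [this, mul_one] at hεε
    · have he := not_dvd_both prime_two hcef.symm h2
      refine unit_of_sq hpair he (Q := τ * q) ?_
      obtain ⟨k, rfl⟩ := h2
      rw [hQ]
      exact ⟨-2 * a * e ^ 2 * k ^ 2 + 4 * ε' * (a ^ 2 - 4 * b) * k ^ 4, by ring⟩
  have hε' : ε' = 1 := by rwa [hε, one_mul] at hεε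
  rw [hε, hε', one_mul, one_mul] at hQ
  obtain ⟨M, hcM, hMN, hsum⟩ := h.factor hf0 hcef hQ
  have key : ∀ K L s : CubicInt, IsCoprime K L → K * L = b * f ^ 4 → K + L = e ^ 2 - a * f ^ 2 →
      ¬ 2 ∣ K → s ^ 2 = 1 → K - L = s * (τ * q) →
      ∃ m n E s : CubicInt, ¬ 2 ∣ m ∧ 2 ∣ n ∧ E ^ 2 = m ^ 4 + a * m ^ 2 * n ^ 2 + b * n ^ 4 ∧
      s ^ 2 = 1 ∧ p * (m ^ 4 - b * n ^ 4) = s * (n * m * E * q) := by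
    intro K L s hKL hprod hsum hK hs hdiff
    obtain ⟨δ, δ', σ, m, n, hpair', hσ, h1, h2, hmn, hm, hE⟩ := h.second_step hf0 hKL hprod hsum hK
    have hσ2 := not_two_dvd_of_isUnit hσ
    have hn : 2 ∣ n := by
      by_contra hn
      have hf : ¬ 2 ∣ f := fun h3 => not_two_dvd_mul hm hn (hmn ▸ h3.mul_left σ)
      have he : 2 ∣ e := (prime_two.dvd_or_dvd h2ef).resolve_right hf
      apply h.no_odd hpair' hm hn
      rw [← hE]
      obtain ⟨k, rfl⟩ := he
      exact ⟨(σ * k) ^ 2, by ring⟩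
    have hδ : δ = 1 := by
      refine unit_of_sq hpair' hm (Q := σ * e) ?_
      obtain ⟨k, rfl⟩ := hn
      rw [hE]
      exact ⟨a * m ^ 2 * k ^ 2 + 4 * b * δ' * k ^ 4, by ring⟩
    have hδ' : δ' = 1 := by
      have := mul_of_mem_unitPairs hpair'
      rwa [hδ, one_mul] at this
    rw [hδ, one_mul] at h1 hE
    rw [hδ', mul_one] at h2 hE
    refine ⟨m, n, σ * e, s, hm, hn, hE, hs, ?_⟩
    linear_combination -p * h1 + p * h2 + σ ^ 2 * p * hdiff - s * q * σ ^ 2 * hef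
      - s * q * σ * e * hmn
  by_cases hM : 2 ∣ M
  · exact key (M + τ * q) M 1 hcM.symm (by linear_combination hMN) (by linear_combination hsum)
      (not_dvd_both prime_two hcM hM) (by ring) (by ring)
  · exact key M (M + τ * q) (-1) hcM hMN hsum hM (by ring) (by ring)

instance : (Ideal.span {(2 : CubicInt)}).IsPrime :=
  (Ideal.span_singleton_prime prime_two.ne_zero).mpr prime_two

/-- The localization of the order at the inert prime `2`. -/
abbrev Loc : Type := Localization.AtPrime (Ideal.span {(2 : CubicInt)})

/-- The inclusion of the order in its localization at `2`. -/
abbrev toLoc : CubicInt →+* Loc := algebraMap CubicInt Loc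

instance : IsDomain Loc :=
  IsLocalization.isDomain_localization (Ideal.primeCompl_le_nonZeroDivisors _)

lemma toLoc_injective : Function.Injective toLoc :=
  IsLocalization.injective _ (Ideal.primeCompl_le_nonZeroDivisors (Ideal.span {(2 : CubicInt)}))

lemma isUnit_toLoc {q : CubicInt} (hq : ¬ 2 ∣ q) : IsUnit (toLoc q) :=
  IsLocalization.map_units Loc
    (⟨q, fun h => hq (Ideal.mem_span_singleton.mp h)⟩ : (Ideal.span {(2 : CubicInt)}).primeCompl)

lemma exists_fraction (z : Loc) :
    ∃ p q : CubicInt, IsCoprime p q ∧ ¬ 2 ∣ q ∧ z * toLoc q = toLoc p := by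
  obtain ⟨⟨x, y⟩, h⟩ := IsLocalization.surj (Ideal.span {(2 : CubicInt)}).primeCompl z
  have hy : ¬ 2 ∣ (y : CubicInt) := fun h => y.2 (Ideal.mem_span_singleton.mpr h)
  obtain ⟨q, p, c, hc, hq, hp⟩ := UniqueFactorizationMonoid.exists_reduced_factors (y : CubicInt)
    (fun h => hy (h ▸ dvd_zero _)) x
  refine ⟨p, q, hc.isCoprime.symm, fun h => hy (hq ▸ h.mul_left c), ?_⟩
  have hc0 : toLoc c ≠ 0 := by
    rw [Ne, map_eq_zero_iff _ toLoc_injective]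
    rintro rfl
    exact hy (by rw [← hq, zero_mul]; exact dvd_zero _)
  apply mul_left_cancel₀ hc0
  simp only at h
  rw [← map_mul, hp, ← h, ← hq, map_mul]; ring

lemma toLoc_two : toLoc 2 = 2 := map_ofNat toLoc 2

lemma two_pow_dvd_of_toLoc {k : ℕ} {x : CubicInt} (h : 2 ^ k ∣ toLoc x) : 2 ^ k ∣ x := by
  obtain ⟨z, hz⟩ := h
  obtain ⟨p, q, -, hq, hpq⟩ := exists_fraction z
  have h1 : x * q = 2 ^ k * p := by
    apply toLoc_injective
    simp only [map_mul, map_pow, map_ofNat]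
    rw [hz, ← hpq]; ring
  exact prime_two.pow_dvd_of_dvd_mul_right k hq (h1 ▸ dvd_mul_right _ _)

lemma prime_two_loc : Prime (2 : Loc) := by
  have h2 : ∀ {x : CubicInt}, 2 ∣ toLoc x → 2 ∣ x := fun h => by
    simpa using two_pow_dvd_of_toLoc (k := 1) (by simpa using h)
  refine ⟨?_, fun h => ?_, fun u v h => ?_⟩
  · have := toLoc_injective.ne (show (2 : CubicInt) ≠ 0 by decide)
    rwa [toLoc_two, map_zero] at this
  · exact prime_two.not_isUnit (isUnit_of_dvd_one (h2 (by rw [map_one]; exact h.dvd)))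
  · obtain ⟨p, q, -, hq, hpq⟩ := exists_fraction u
    obtain ⟨p', q', -, hq', hpq'⟩ := exists_fraction v
    have h3 : 2 ∣ toLoc (p * p') := by
      rw [map_mul, ← hpq, ← hpq', show u * toLoc q * (v * toLoc q') =
        u * v * (toLoc q * toLoc q') by ring]
      exact h.mul_right _
    rcases prime_two.dvd_or_dvd (h2 h3) with h4 | h4
    · left
      have := map_dvd toLoc h4
      rw [← hpq, map_ofNat] at this
      exact (isUnit_toLoc hq).dvd_mul_right.mp this
    · right
      have := map_dvd toLoc h4
      rw [← hpq', map_ofNat] at this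
      exact (isUnit_toLoc hq').dvd_mul_right.mp this

lemma isUnit_of_not_two_dvd {z : Loc} (h : ¬ 2 ∣ z) : IsUnit z := by
  obtain ⟨p, q, -, hq, hpq⟩ := exists_fraction z
  have hp : ¬ 2 ∣ p := by
    intro h1
    have := map_dvd toLoc h1
    rw [← hpq, map_ofNat] at this
    exact h ((isUnit_toLoc hq).dvd_mul_right.mp this)
  have h1 := isUnit_toLoc hp
  rw [← hpq] at h1
  exact isUnit_of_mul_isUnit_left h1

lemma isUnit_of_two_dvd_sub_one {z : Loc} (h : 2 ∣ z - 1) : IsUnit z := by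
  apply isUnit_of_not_two_dvd
  intro h1
  apply prime_two_loc.not_isUnit
  apply isUnit_of_dvd_one
  rw [show (1 : Loc) = z - (z - 1) by ring]
  exact dvd_sub h1 h

/-- The points of `w² = 1 + a z² + b z⁴` over the localization at `2`. -/
def OnCurve (a b : CubicInt) (z w : Loc) : Prop :=
  w ^ 2 = 1 + toLoc a * z ^ 2 + toLoc b * z ^ 4

lemma OnCurve.exists_integral {z w : Loc} (h : OnCurve a b z w) :
    ∃ p q W : CubicInt, IsCoprime p q ∧ ¬ 2 ∣ q ∧ z * toLoc q = toLoc p ∧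
      W ^ 2 = q ^ 4 + a * p ^ 2 * q ^ 2 + b * p ^ 4 := by
  obtain ⟨p, q, hc, hq, hpq⟩ := exists_fraction z
  obtain ⟨n, d, -, hd, hnd⟩ := exists_fraction w
  have h1 : (n * q ^ 2) ^ 2 = d ^ 2 * (q ^ 4 + a * p ^ 2 * q ^ 2 + b * p ^ 4) := by
    apply toLoc_injective
    simp only [map_mul, map_pow, map_add]
    rw [← hpq, ← hnd]
    unfold OnCurve at h
    linear_combination (toLoc d) ^ 2 * (toLoc q) ^ 4 * h
  have h2 : d ∣ n * q ^ 2 := by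
    rw [← IsIntegrallyClosed.pow_dvd_pow_iff (n := 2) two_ne_zero]
    exact h1 ▸ dvd_mul_right _ _
  obtain ⟨W, hW⟩ := h2
  refine ⟨p, q, W, hc, hq, hpq, ?_⟩
  have hd0 : d ^ 2 ≠ 0 := pow_ne_zero _ (fun h0 => hd (h0 ▸ dvd_zero _))
  apply mul_left_cancel₀ hd0
  rw [← h1, hW]; ring

lemma OnCurve.exists_integral_even {z w : Loc} (h : OnCurve a b z w) (hz : 2 ∣ z) :
    ∃ p q W : CubicInt, IsCoprime p q ∧ ¬ 2 ∣ q ∧ z * toLoc q = 2 * toLoc p ∧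
      W ^ 2 = q ^ 4 + 4 * a * p ^ 2 * q ^ 2 + 16 * b * p ^ 4 := by
  obtain ⟨p, q, W, hc, hq, hpq, hW⟩ := h.exists_integral
  have hp : 2 ^ 1 ∣ toLoc p := by rw [pow_one, ← hpq]; exact hz.mul_right _
  obtain ⟨p, rfl⟩ := two_pow_dvd_of_toLoc hp
  refine ⟨p, q, W, IsCoprime.of_mul_left_right hc, hq, by rw [hpq, pow_one, map_mul, toLoc_two], ?_⟩
  rw [hW]; ring

lemma Descent.two_adic_one (hd : Descent a b ζ) {z w : Loc} (h : OnCurve a b z w) (hz : 2 ∣ z) :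
    4 ∣ z ∨ 4 ∣ z - 2 * toLoc ζ := by
  obtain ⟨p, q, W, hc, hq, hpq, hW⟩ := h.exists_integral_even hz
  by_cases hp : 2 ∣ p
  · left
    apply (isUnit_toLoc hq).dvd_mul_right.mp
    obtain ⟨k, rfl⟩ := hp
    exact ⟨toLoc k, by rw [hpq, map_mul, map_ofNat]; ring⟩
  · right
    apply (isUnit_toLoc hq).dvd_mul_right.mp
    obtain ⟨k, hk⟩ := hd.base_step hc hp hq hW
    refine ⟨toLoc k, ?_⟩
    have := congrArg toLoc hk
    simp only [map_sub, map_mul, map_ofNat] at this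
    linear_combination hpq + 2 * this

lemma Descent.exists_half (hd : Descent a b ζ) {z w : Loc} (h : OnCurve a b z w) (hz : 4 ∣ z)
    (h0 : z ≠ 0) :
    ∃ z' w' s : Loc, OnCurve a b z' w' ∧ 2 ∣ z' ∧ (s = 1 ∨ s = -1) ∧
      z * (1 - toLoc b * z' ^ 4) = 2 * s * z' * w' := by
  obtain ⟨p, q, W, hc, hq, hpq, hW⟩ :=
    h.exists_integral_even (dvd_trans ⟨2, by norm_num⟩ hz)
  have h2 := prime_two_loc.ne_zero
  have hp : 2 ^ 1 ∣ toLoc p := by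
    obtain ⟨k, rfl⟩ := hz
    refine ⟨k * toLoc q, ?_⟩
    apply mul_left_cancel₀ h2
    linear_combination -hpq
  have hp0 : p ≠ 0 := by
    rintro rfl
    rw [map_zero, mul_zero, mul_eq_zero] at hpq
    exact hpq.elim h0 (isUnit_toLoc hq).ne_zero
  obtain ⟨m, n, E, s, hm, hn, hE, hs, hrel⟩ :=
    hd.halving hc hp0 (by simpa using two_pow_dvd_of_toLoc hp) hq hW
  obtain ⟨v, hv⟩ := (isUnit_toLoc hm).exists_right_inv
  have hE' := congrArg toLoc hE
  have hrel' := congrArg toLoc hrel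
  simp only [map_mul, map_sub, map_add, map_pow] at hE' hrel'
  refine ⟨toLoc n * v, toLoc E * v ^ 2, toLoc s, ?_, ?_, ?_, ?_⟩
  · unfold OnCurve
    linear_combination v ^ 4 * hE' + (toLoc m * v + 1) * (toLoc m ^ 2 * v ^ 2 + 1) * hv
      + toLoc a * toLoc n ^ 2 * v ^ 2 * (toLoc m * v + 1) * hv
  · refine Dvd.dvd.mul_right ?_ _
    rw [← toLoc_two]
    exact map_dvd toLoc hn
  · rcases sq_eq_one_iff.mp hs with rfl | rfl
    · exact Or.inl (map_one _)
    · exact Or.inr (by rw [map_neg, map_one])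
  · have h1 : z * (toLoc m ^ 4 - toLoc b * toLoc n ^ 4) =
        2 * toLoc s * toLoc n * toLoc m * toLoc E := by
      apply mul_right_cancel₀ (isUnit_toLoc hq).ne_zero
      linear_combination (toLoc m ^ 4 - toLoc b * toLoc n ^ 4) * hpq + 2 * hrel'
    linear_combination v ^ 4 * h1 + (2 * toLoc s * toLoc n * toLoc E * v ^ 3
      - z * (toLoc m * v + 1) * (toLoc m ^ 2 * v ^ 2 + 1)) * hv

lemma OnCurve.two_dvd_sub_one {z w : Loc} (h : OnCurve a b z w) (hz : 2 ∣ z) : 2 ∣ w - 1 := by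
  obtain ⟨y, rfl⟩ := hz
  unfold OnCurve at h
  have h1 : (2 : Loc) ∣ (w - 1) * (w + 1) :=
    ⟨2 * toLoc a * y ^ 2 + 8 * toLoc b * y ^ 4, by linear_combination h⟩
  rcases prime_two_loc.dvd_or_dvd h1 with ⟨k, hk⟩ | ⟨k, hk⟩
  · exact ⟨k, hk⟩
  · exact ⟨k - 1, by linear_combination hk⟩

lemma OnCurve.exists_sign {z w : Loc} (h : OnCurve a b z w) {M : ℕ} (hz : 2 ^ (M + 1) ∣ z) :
    ∃ η : ℤ, (η = 1 ∨ η = -1) ∧ 2 ^ (2 * M + 1) ∣ w - η := by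
  obtain ⟨t, ht⟩ := h.two_dvd_sub_one ((dvd_pow_self 2 M.succ_ne_zero).trans hz)
  obtain ⟨y, rfl⟩ := hz
  have h4 : (2 : Loc) ^ 2 ≠ 0 := pow_ne_zero _ prime_two_loc.ne_zero
  have h1 : 2 ^ (2 * M) ∣ t * (t + 1) := by
    refine ⟨y ^ 2 * (toLoc a + toLoc b * (2 ^ (M + 1) * y) ^ 2), ?_⟩
    apply mul_left_cancel₀ h4
    unfold OnCurve at h
    linear_combination h - (w + 1 + 2 * t) * ht
  by_cases h2 : 2 ∣ t
  · have h3 : ¬ 2 ∣ t + 1 := fun h3 => prime_two_loc.not_isUnit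
      (isUnit_of_dvd_one (by simpa using dvd_sub h3 h2))
    obtain ⟨k, hk⟩ := prime_two_loc.pow_dvd_of_dvd_mul_right _ h3 h1
    exact ⟨1, Or.inl rfl, k, by push_cast; linear_combination ht + 2 * hk⟩
  · obtain ⟨k, hk⟩ := prime_two_loc.pow_dvd_of_dvd_mul_left _ h2 h1
    exact ⟨-1, Or.inr rfl, k, by push_cast; linear_combination ht + 2 * hk⟩

lemma Descent.exists_half_modEq (hd : Descent a b ζ) {z w : Loc} (h : OnCurve a b z w) {M : ℕ}
    (hz : 2 ^ (M + 2) ∣ z) :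
    ∃ (z' w' : Loc) (σ : ℤ), OnCurve a b z' w' ∧ 2 ^ (M + 1) ∣ z' ∧ (σ = 1 ∨ σ = -1) ∧
      2 ^ (3 * M + 3) ∣ z - 2 * σ * z' := by
  by_cases h0 : z = 0
  · exact ⟨0, 1, 1, by simp [OnCurve], dvd_zero _, Or.inl rfl, by simp [h0]⟩
  obtain ⟨z', w', s, h', hz', hs, hrel⟩ := hd.exists_half h
    (((show (4 : Loc) = 2 ^ 2 by norm_num) ▸ pow_dvd_pow 2 (Nat.le_add_left 2 M)).trans hz) h0
  have hw : IsUnit w' := isUnit_of_two_dvd_sub_one (h'.two_dvd_sub_one hz')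
  have hsu : IsUnit s := by
    rcases hs with rfl | rfl
    · exact isUnit_one
    · exact isUnit_one.neg
  have hM : 2 ^ (M + 1) ∣ z' := by
    have h1 : (2 : Loc) ^ (M + 1) ∣ z' * (s * w') := by
      obtain ⟨y, rfl⟩ := hz
      refine ⟨y * (1 - toLoc b * z' ^ 4), ?_⟩
      apply mul_left_cancel₀ prime_two_loc.ne_zero
      linear_combination -hrel
    exact (hsu.mul hw).dvd_mul_right.mp h1
  obtain ⟨η, hη, k, hk⟩ := h'.exists_sign hM
  obtain ⟨σ, hσ1, hσ⟩ : ∃ σ : ℤ, (σ = 1 ∨ σ = -1) ∧ (σ : Loc) = s * η := by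
    rcases hs with rfl | rfl
    · exact ⟨η, hη, by simp⟩
    · exact ⟨-η, by omega, by simp⟩
  refine ⟨z', w', σ, h', hM, hσ1, ?_⟩
  obtain ⟨y, hy⟩ := hz
  obtain ⟨x, hx⟩ := hM
  refine ⟨2 ^ (2 * M + 3) * y * toLoc b * x ^ 4 + s * x * k, ?_⟩
  have e1 : z - 2 * σ * z' = z * toLoc b * z' ^ 4 + 2 * s * z' * (w' - η) := by
    rw [hσ]; linear_combination hrel
  rw [e1, hk, hy, hx]; ring

lemma exists_eq_one_add_of_sign {η : ℤ} (h : η = 1 ∨ η = -1) : ∃ k : Loc, (η : Loc) = 1 + 2 * k := by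
  rcases h with rfl | rfl
  · exact ⟨0, by simp⟩
  · exact ⟨-1, by norm_num⟩

lemma Descent.two_adic (hd : Descent a b ζ) (M : ℕ) :
    ∀ {z w : Loc}, OnCurve a b z w → 2 ^ (M + 1) ∣ z →
      2 ^ (M + 2) ∣ z ∨ 2 ^ (M + 2) ∣ z - 2 ^ (M + 1) * toLoc ζ := by
  induction M with
  | zero =>
    intro z w h hz
    have := hd.two_adic_one h (by simpa using hz)
    rw [show (2 : Loc) ^ (0 + 2) = 4 by norm_num, show (2 : Loc) ^ (0 + 1) = 2 by norm_num]
    exact this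
  | succ M ih =>
    intro z w h hz
    obtain ⟨z', w', σ, h', hz', hσ, k, hk⟩ := hd.exists_half_modEq h hz
    obtain ⟨l, hl⟩ := exists_eq_one_add_of_sign hσ
    rcases ih h' hz' with ⟨y, hy⟩ | ⟨y, hy⟩
    · exact Or.inl ⟨2 ^ (2 * M) * k + σ * y, by linear_combination hk + 2 * σ * hy⟩
    · exact Or.inr ⟨2 ^ (2 * M) * k + σ * y + l * toLoc ζ, by
        linear_combination hk + 2 * σ * hy + 2 ^ (M + 2) * toLoc ζ * hl⟩

lemma curve_add {R : Type*} [CommRing R] {a b z₁ w₁ z₂ w₂ v : R}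
    (h₁ : w₁ ^ 2 = 1 + a * z₁ ^ 2 + b * z₁ ^ 4) (h₂ : w₂ ^ 2 = 1 + a * z₂ ^ 2 + b * z₂ ^ 4)
    (hv : v * (1 - b * z₁ ^ 2 * z₂ ^ 2) = 1) :
    (((1 + b * z₁ ^ 2 * z₂ ^ 2) * (w₁ * w₂ + a * z₁ * z₂) + 2 * b * z₁ * z₂ * (z₁ ^ 2 + z₂ ^ 2))
      * v ^ 2) ^ 2 =
    1 + a * ((z₁ * w₂ + z₂ * w₁) * v) ^ 2 + b * ((z₁ * w₂ + z₂ * w₁) * v) ^ 4 := by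
  obtain ⟨x, hx⟩ : ∃ x, x = w₁ * w₂ := ⟨_, rfl⟩
  obtain ⟨n, hn⟩ : ∃ n, n = z₁ * w₂ + z₂ * w₁ := ⟨_, rfl⟩
  obtain ⟨d, hd⟩ : ∃ d, d = 1 - b * z₁ ^ 2 * z₂ ^ 2 := ⟨_, rfl⟩
  have hx2 : x ^ 2 = (1 + a * z₁ ^ 2 + b * z₁ ^ 4) * (1 + a * z₂ ^ 2 + b * z₂ ^ 4) := by
    rw [hx]; linear_combination w₂ ^ 2 * h₁ + (1 + a * z₁ ^ 2 + b * z₁ ^ 4) * h₂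
  have hn2 : n ^ 2 = z₁ ^ 2 * (1 + a * z₂ ^ 2 + b * z₂ ^ 4)
      + z₂ ^ 2 * (1 + a * z₁ ^ 2 + b * z₁ ^ 4) + 2 * z₁ * z₂ * x := by
    rw [hn, hx]; linear_combination z₁ ^ 2 * h₂ + z₂ ^ 2 * h₁
  rw [← hn, ← hx]
  rw [← hd] at hv
  have key : ((1 + b * z₁ ^ 2 * z₂ ^ 2) * (x + a * z₁ * z₂)
      + 2 * b * z₁ * z₂ * (z₁ ^ 2 + z₂ ^ 2)) ^ 2 = d ^ 4 + a * n ^ 2 * d ^ 2 + b * n ^ 4 := by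
    rw [show n ^ 4 = (n ^ 2) ^ 2 by ring, hn2, hd]
    linear_combination ((1 + b * z₁ ^ 2 * z₂ ^ 2) ^ 2 - b * (2 * z₁ * z₂) ^ 2) * hx2
  linear_combination v ^ 4 * key + ((v * d + 1) * (v ^ 2 * d ^ 2 + 1)
    + a * n ^ 2 * v ^ 2 * (v * d + 1)) * hv

lemma OnCurve.exists_add {z₁ w₁ z₂ w₂ : Loc} (h₁ : OnCurve a b z₁ w₁) (h₂ : OnCurve a b z₂ w₂)
    (h : 2 ∣ z₁) :
    ∃ z₃ w₃ : Loc, OnCurve a b z₃ w₃ ∧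
      z₃ * (1 - toLoc b * z₁ ^ 2 * z₂ ^ 2) = z₁ * w₂ + z₂ * w₁ := by
  obtain ⟨v, hv⟩ := (isUnit_of_two_dvd_sub_one (z := 1 - toLoc b * z₁ ^ 2 * z₂ ^ 2) (by
    rw [show 1 - toLoc b * z₁ ^ 2 * z₂ ^ 2 - 1 = z₁ * (-toLoc b * z₁ * z₂ ^ 2) by ring]
    exact h.mul_right _)).exists_left_inv
  exact ⟨_, _, curve_add h₁ h₂ hv, by linear_combination (z₁ * w₂ + z₂ * w₁) * hv⟩

lemma OnCurve.neg {z w : Loc} (h : OnCurve a b z w) : OnCurve a b (-z) w := by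
  unfold OnCurve at *
  linear_combination h

/-- Points in the formal group are approximated by integer multiples of a generator. -/
lemma Descent.exists_multiple (hd : Descent a b 1) {M : ℕ} {s ws : Loc} (hs : OnCurve a b s ws)
    (hs1 : 2 ^ (M + 2) ∣ s - 2 ^ (M + 1)) (j : ℕ) (hj : j ≤ 2 * M + 1) :
    ∀ {z w : Loc}, OnCurve a b z w → 2 ^ (M + 1) ∣ z → ∃ r : ℤ, 2 ^ (M + 1 + j) ∣ z - r * s := by
  induction j with
  | zero => exact fun _ hz => ⟨0, by simpa using hz⟩
  | succ j ih =>
    have even : ∀ {z w : Loc}, OnCurve a b z w → 2 ^ (M + 2) ∣ z →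
        ∃ r : ℤ, 2 ^ (M + 1 + (j + 1)) ∣ z - r * s := by
      intro z w h hz
      obtain ⟨z', w', σ, h', hz', -, hmod⟩ := hd.exists_half_modEq h hz
      obtain ⟨r, hr⟩ := ih (by omega) h' hz'
      refine ⟨2 * σ * r, ?_⟩
      have e : z - ((2 * σ * r : ℤ) : Loc) * s = (z - 2 * σ * z') + σ * (2 * (z' - r * s)) := by
        push_cast; ring
      rw [e]
      refine dvd_add ((pow_dvd_pow 2 (by omega)).trans hmod) (Dvd.dvd.mul_left ?_ _)
      rw [← add_assoc, pow_succ']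
      exact mul_dvd_mul_left 2 hr
    intro z w h hz
    rcases hd.two_adic M h hz with hz2 | hz2
    · exact even h hz2
    have hs0 : 2 ^ (M + 1) ∣ s := by
      have := dvd_add ((pow_dvd_pow 2 (Nat.le_succ (M + 1))).trans hs1) (dvd_refl ((2 : Loc) ^ (M + 1)))
      rwa [sub_add_cancel] at this
    obtain ⟨η₁, hη₁, k₁, hk₁⟩ := h.exists_sign hz
    obtain ⟨η₂, hη₂, k₂, hk₂⟩ := hs.exists_sign hs0
    obtain ⟨z₃, w₃, h₃, hz₃⟩ := h.exists_add hs.neg ((dvd_pow_self 2 M.succ_ne_zero).trans hz)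
    obtain ⟨y, hy⟩ := hz
    obtain ⟨x, hx⟩ := hs0
    obtain ⟨l₁, hl₁⟩ := exists_eq_one_add_of_sign hη₁
    obtain ⟨l₂, hl₂⟩ := exists_eq_one_add_of_sign hη₂
    obtain ⟨c, hc⟩ := hz2
    obtain ⟨d, hdd⟩ := hs1
    have e : z₃ - (η₂ * z - η₁ * s) =
        2 ^ (3 * M + 2) * (2 ^ (M + 2) * z₃ * toLoc b * y ^ 2 * x ^ 2 + y * k₂ - x * k₁) := by
      have e1 : z₃ - (η₂ * z - η₁ * s) =
          z₃ * toLoc b * z ^ 2 * s ^ 2 + z * (ws - η₂) - s * (w - η₁) := by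
        linear_combination hz₃
      rw [e1, hk₁, hk₂, hy, hx]; ring
    rw [map_one] at hc
    obtain ⟨r, hr⟩ := even h₃ ⟨2 ^ (2 * M) * (2 ^ (M + 2) * z₃ * toLoc b * y ^ 2 * x ^ 2 + y * k₂
      - x * k₁) + c - d + l₂ * y - l₁ * x, by
        linear_combination e + hc - hdd + z * hl₂ - s * hl₁ + 2 * l₂ * hy - 2 * l₁ * hx⟩
    refine ⟨η₂ * (r + η₁), ?_⟩
    have hsq : (η₂ : Loc) * η₂ = 1 := by rcases hη₂ with rfl | rfl <;> simp
    have e2 : z - ((η₂ * (r + η₁) : ℤ) : Loc) * s =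
        η₂ * (z₃ - r * s) - η₂ * (z₃ - (η₂ * z - η₁ * s)) := by
      push_cast; linear_combination -z * hsq
    rw [e2, e]
    exact dvd_sub (hr.mul_left _) (((pow_dvd_pow 2 (by omega)).mul_right _).mul_left _)

lemma OnCurve.exists_double {z w : Loc} (h : OnCurve a b z w) (hz : 2 ∣ z) :
    ∃ z' w' v : Loc, OnCurve a b z' w' ∧ v * (1 - toLoc b * z ^ 4) = 1 ∧ 2 ∣ v - 1 ∧
      z' = 2 * z * w * v := by
  obtain ⟨v, hv⟩ := (isUnit_of_two_dvd_sub_one (z := 1 - toLoc b * z ^ 2 * z ^ 2) (by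
    rw [show 1 - toLoc b * z ^ 2 * z ^ 2 - 1 = z * (-toLoc b * z * z ^ 2) by ring]
    exact hz.mul_right _)).exists_left_inv
  obtain ⟨y, rfl⟩ := hz
  refine ⟨_, _, v, curve_add h h hv, by linear_combination hv, ?_, by ring⟩
  exact ⟨8 * toLoc b * v * y ^ 4, by linear_combination hv⟩

lemma two_dvd_sub_iff {x y : Loc} :
    2 ∣ x - y ↔ Ideal.Quotient.mk (Ideal.span {(2 : Loc)}) x = Ideal.Quotient.mk _ y := by
  rw [Ideal.Quotient.eq, Ideal.mem_span_singleton]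

lemma double_step {z w z' w' v v' g g' ρ y A B : Loc} (n : ℕ)
    (h : w ^ 2 = 1 + A * z ^ 2 + B * z ^ 4) (h' : w' ^ 2 = 1 + A * z' ^ 2 + B * z' ^ 4)
    (hw : 2 ∣ w - 1) (hv : v * (1 - B * z ^ 4) = 1) (hv' : v' * (1 - B * z' ^ 4) = 1)
    (hv1 : 2 ∣ v - 1) (hv1' : 2 ∣ v' - 1) (hg' : 2 ∣ g' - 1) (hz : 2 ∣ z) (hz' : 2 ∣ z')
    (hy : 2 ∣ y) (hzg : z = 2 ^ n * y * g) (hzg' : z' = 2 ^ n * 2 * g')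
    (hρ : g ^ 2 - g' ^ 2 = (y ^ 2 - 4) * ρ) :
    ∃ ρ', (g * w * v) ^ 2 - (g' * w' * v') ^ 2 = (y ^ 2 - 4) * ρ' ∧ 2 ∣ ρ' - (ρ + 4 ^ n * A) := by
  obtain ⟨K, hK⟩ : ∃ K, K = A + B * (z ^ 2 + z' ^ 2)
      + 2 * B * ((z ^ 2 + z' ^ 2) + A * z ^ 2 * z' ^ 2)
      - B ^ 2 * ((z ^ 2 + z' ^ 2) * (z ^ 4 + z' ^ 4)
        + A * z ^ 2 * z' ^ 2 * (z ^ 4 + z ^ 2 * z' ^ 2 + z' ^ 4)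
        + B * z ^ 4 * z' ^ 4 * (z ^ 2 + z' ^ 2)) := ⟨_, rfl⟩
  have hφ : (w * v) ^ 2 - (w' * v') ^ 2 = (z ^ 2 - z' ^ 2) * K * v ^ 2 * v' ^ 2 := by
    have e1 : (w * v) ^ 2 = w ^ 2 * v ^ 2 * (v' * (1 - B * z' ^ 4)) ^ 2 := by rw [hv']; ring
    have e2 : (w' * v') ^ 2 = w' ^ 2 * v' ^ 2 * (v * (1 - B * z ^ 4)) ^ 2 := by rw [hv]; ring
    rw [e1, e2, h, h', hK]; ring
  refine ⟨ρ * w ^ 2 * v ^ 2 + g' ^ 2 * (4 ^ n * (y ^ 2 * ρ + g' ^ 2)) * K * v ^ 2 * v' ^ 2, ?_, ?_⟩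
  · have e : z ^ 2 - z' ^ 2 = 4 ^ n * (y ^ 2 - 4) * (y ^ 2 * ρ + g' ^ 2) := by
      rw [hzg, hzg', show (4 : Loc) ^ n = (2 ^ n) ^ 2 by rw [← pow_mul, mul_comm, pow_mul]; norm_num]
      linear_combination (2 ^ n) ^ 2 * y ^ 2 * hρ
    linear_combination (w * v) ^ 2 * hρ + g' ^ 2 * hφ + g' ^ 2 * K * v ^ 2 * v' ^ 2 * e
  · rw [hK]
    rw [two_dvd_sub_iff] at *
    have zero : ∀ {x : Loc}, 2 ∣ x → Ideal.Quotient.mk (Ideal.span {(2 : Loc)}) x = 0 := by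
      intro x hx
      rwa [Ideal.Quotient.eq_zero_iff_mem, Ideal.mem_span_singleton]
    simp only [map_add, map_sub, map_mul, map_pow, hw, hv1, hv1', hg', zero hz, zero hz', zero hy,
      map_one]
    ring

lemma OnCurve.iterate_double {z w t : Loc} (h : OnCurve a b z w) (hz : 2 ∣ z)
    (ht : OnCurve a b 2 t) (n : ℕ) :
    ∃ z' w' s' t' g g' ρ : Loc, OnCurve a b z' w' ∧ OnCurve a b s' t' ∧ z' = 2 ^ n * z * g ∧
      s' = 2 ^ n * 2 * g' ∧ 2 ∣ g' - 1 ∧ g ^ 2 - g' ^ 2 = (z ^ 2 - 4) * ρ ∧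
      (n = 0 ∧ ρ = 0 ∨ 0 < n ∧ 2 ∣ ρ - toLoc a) := by
  induction n with
  | zero => exact ⟨z, w, 2, t, 1, 1, 0, h, ht, by simp, by simp, by simp, by simp, by simp⟩
  | succ n ih =>
    obtain ⟨z', w', s', t', g, g', ρ, h1, h2, hz', hs', hg', hρ, hn⟩ := ih
    have hz2 : 2 ∣ z' := hz' ▸ ((hz.mul_left _).mul_right _)
    have hs2 : 2 ∣ s' := hs' ▸ ((dvd_mul_left _ _).mul_right _)
    obtain ⟨z₁, w₁, v, h₁, hv, hv1, rfl⟩ := h1.exists_double hz2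
    obtain ⟨s₁, t₁, v', h₂, hv', hv1', rfl⟩ := h2.exists_double hs2
    have hw' := h1.two_dvd_sub_one hz2
    have ht' := h2.two_dvd_sub_one hs2
    obtain ⟨ρ', hρ', hmod⟩ := double_step n h1 h2 hw' hv hv' hv1 hv1' hg' hz2 hs2 hz hz' hs' hρ
    refine ⟨_, w₁, _, t₁, g * w' * v, g' * t' * v', ρ', h₁, h₂, ?_, ?_, ?_, hρ', Or.inr ⟨n.succ_pos, ?_⟩⟩
    · linear_combination 2 * w' * v * hz'
    · linear_combination 2 * t' * v' * hs'
    · rw [two_dvd_sub_iff] at *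
      simp [hg', ht', hv1']
    · rcases hn with ⟨rfl, rfl⟩ | ⟨hpos, hn⟩
      · simpa using hmod
      · have e : ρ' - toLoc a = (ρ' - (ρ + 4 ^ n * toLoc a)) + (ρ - toLoc a)
          + 4 ^ n * toLoc a := by ring
        rw [e]
        refine dvd_add (dvd_add hmod hn) (Dvd.dvd.mul_right ?_ _)
        exact dvd_pow ⟨2, by norm_num⟩ hpos.ne'

lemma exists_point {p q : ℤ} {W : CubicInt} (hq : ¬ 2 ∣ q)
    (h : W ^ 2 = (q : CubicInt) ^ 4 + a * (p : CubicInt) ^ 2 * (q : CubicInt) ^ 2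
      + b * (p : CubicInt) ^ 4) :
    ∃ z w : Loc, OnCurve a b z w ∧ z * q = p ∧ IsUnit (q : Loc) := by
  have hq' : ¬ 2 ∣ (q : CubicInt) := fun h => hq ((two_dvd_iff _).mp h).1
  have hu := isUnit_toLoc hq'
  rw [map_intCast] at hu
  obtain ⟨v, hv⟩ := hu.exists_left_inv
  refine ⟨p * v, toLoc W * v ^ 2, ?_, by linear_combination (p : Loc) * hv, hu⟩
  have h1 := congrArg toLoc h
  simp only [map_add, map_mul, map_pow, map_intCast] at h1
  unfold OnCurve
  linear_combination v ^ 4 * h1 + ((v * q + 1) * (v ^ 2 * q ^ 2 + 1)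
    + toLoc a * p ^ 2 * v ^ 2 * (v * q + 1)) * hv

lemma two_pow_dvd_of_intCast {k : ℕ} {n : ℤ} (h : 2 ^ k ∣ (n : Loc)) : 2 ^ k ∣ n := by
  rw [← map_intCast toLoc] at h
  have h1 := two_pow_dvd_of_toLoc h
  have h2 : ((2 ^ k : ℤ) : CubicInt) ∣ (n : CubicInt) := by push_cast; exact h1
  exact ((dvd_iff _ _).mp h2).1

lemma even_of_dvd_add_mul_α {m n : ℤ} (h : 2 ∣ (m : Loc) + toLoc α * n) : 2 ∣ n := by
  have h1 : 2 ^ 1 ∣ toLoc (m + α * n) := by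
    rw [map_add, map_mul, map_intCast, map_intCast, pow_one]; exact h
  have h2 := two_pow_dvd_of_toLoc h1
  rw [pow_one, two_dvd_iff] at h2
  simpa using h2.2.1

lemma first_curve_points {p q : ℤ} {W : CubicInt} (hq : ¬ 2 ∣ q) (hp : 2 ∣ p)
    (h : W ^ 2 = (q : CubicInt) ^ 4 + α * (p : CubicInt) ^ 2 * (q : CubicInt) ^ 2
      + -β * (p : CubicInt) ^ 4) :
    p = 0 ∨ p ^ 2 = 4 * q ^ 2 := by
  obtain ⟨z, w, hzw, hz, hqu⟩ := exists_point hq h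
  have hz2 : 2 ∣ z := by
    apply hqu.dvd_mul_right.mp
    rw [hz]
    obtain ⟨k, rfl⟩ := hp
    exact ⟨k, by push_cast; ring⟩
  have hP : OnCurve α (-β) 2 (toLoc ⟨1, -4, 2⟩) := by
    unfold OnCurve
    rw [← toLoc_two, ← map_one toLoc]
    simp only [← map_mul, ← map_pow, ← map_add]
    exact congrArg toLoc (by decide)
  by_contra! hne
  have hi : p ^ 2 * (p ^ 2 - 4 * q ^ 2) ≠ 0 :=
    mul_ne_zero (pow_ne_zero 2 hne.1) (sub_ne_zero.mpr hne.2)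
  obtain ⟨m, n₂, hn₂, hi₂⟩ : ∃ (m : ℕ) (n₂ : ℤ), ¬ 2 ∣ n₂ ∧
      p ^ 2 * (p ^ 2 - 4 * q ^ 2) = 2 ^ m * n₂ := by
    have hf : FiniteMultiplicity 2 (p ^ 2 * (p ^ 2 - 4 * q ^ 2)) :=
      Int.finiteMultiplicity_iff.mpr ⟨by decide, hi⟩
    obtain ⟨c, hc, hc'⟩ := hf.exists_eq_pow_mul_and_not_dvd
    exact ⟨_, c, hc', hc⟩
  obtain ⟨zN, wN, s, t, g, g', ρ, h₁, h₂, hzN, hs, hg', hρ, hn⟩ :=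
    hzw.iterate_double hz2 hP (m + 1)
  obtain ⟨-, hρ2⟩ := hn.resolve_left (by omega)
  obtain ⟨r, c, hr⟩ := descent_first.exists_multiple h₂ (M := m + 1) (by
      obtain ⟨k, hk⟩ := hg'
      exact ⟨k, by rw [hs]; linear_combination 2 ^ (m + 2) * hk⟩) (2 * (m + 1) + 1) le_rfl h₁ (by
      obtain ⟨k, rfl⟩ := hz2
      exact ⟨k * g, by rw [hzN]; ring⟩)
  have h2 := prime_two_loc.ne_zero
  have hc : z * g - r * 2 * g' = 2 ^ (2 * m + 4) * c := by
    apply mul_left_cancel₀ (pow_ne_zero (m + 1) h2)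
    rw [hzN, hs] at hr
    linear_combination hr
  have hsum : g' ^ 2 * ((q ^ 2 * p ^ 2 - 4 * r ^ 2 * q ^ 4 : ℤ) : Loc)
      + ((p ^ 2 * (p ^ 2 - 4 * q ^ 2) : ℤ) : Loc) * ρ =
      2 ^ (2 * m + 4) * (c * (z * g + r * 2 * g') * q ^ 4) := by
    push_cast
    rw [← hz]
    linear_combination (z * g + r * 2 * g') * q ^ 4 * hc - z ^ 2 * q ^ 4 * hρ
  have hg'u := isUnit_of_two_dvd_sub_one hg'
  rw [hi₂] at hsum
  push_cast at hsum
  obtain ⟨n₁, hn₁⟩ : 2 ^ m ∣ q ^ 2 * p ^ 2 - 4 * r ^ 2 * q ^ 4 := by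
    apply two_pow_dvd_of_intCast
    apply (hg'u.pow 2).dvd_mul_left.mp
    push_cast
    exact ⟨2 ^ (m + 4) * (c * (z * g + r * 2 * g') * q ^ 4) - n₂ * ρ, by
      linear_combination hsum⟩
  have hn₁' := congrArg (Int.cast : ℤ → Loc) hn₁
  push_cast at hn₁'
  rw [hn₁'] at hsum
  have hfin : g' ^ 2 * n₁ + n₂ * ρ = 2 * (2 ^ (m + 3) * (c * (z * g + r * 2 * g') * q ^ 4)) := by
    apply mul_left_cancel₀ (pow_ne_zero m h2)
    linear_combination hsum
  apply hn₂
  apply even_of_dvd_add_mul_α (m := n₁)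
  obtain ⟨k, hk⟩ := hg'
  obtain ⟨l, hl⟩ := hρ2
  exact ⟨2 ^ (m + 3) * (c * (z * g + r * 2 * g') * q ^ 4) - n₁ * (g' + 1) * k - n₂ * l, by
    linear_combination hfin - n₁ * (g' + 1) * hk - n₂ * hl⟩

lemma second_curve_points {p q : ℤ} {W : CubicInt} (hq : ¬ 2 ∣ q) (hp : 2 ∣ p)
    (h : W ^ 2 = (q : CubicInt) ^ 4 + -α ^ 2 * (p : CubicInt) ^ 2 * (q : CubicInt) ^ 2
      + -α * (p : CubicInt) ^ 4) :
    p = 0 := by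
  obtain ⟨z, w, hzw, hz, hqu⟩ := exists_point hq h
  by_contra h0
  obtain ⟨m, n, hn, hpn⟩ : ∃ (m : ℕ) (n : ℤ), ¬ 2 ∣ n ∧ p = 2 ^ m * n := by
    have hf : FiniteMultiplicity 2 p := Int.finiteMultiplicity_iff.mpr ⟨by decide, h0⟩
    obtain ⟨c, hc, hc'⟩ := hf.exists_eq_pow_mul_and_not_dvd
    exact ⟨_, c, hc', hc⟩
  obtain ⟨M, rfl⟩ : ∃ M, m = M + 1 := by
    refine Nat.exists_eq_succ_of_ne_zero ?_
    rintro rfl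
    exact hn (by simpa [hpn] using hp)
  have hpL := congrArg (Int.cast : ℤ → Loc) hpn
  push_cast at hpL
  have h2 := pow_ne_zero (M + 1) prime_two_loc.ne_zero
  have hzM : 2 ^ (M + 1) ∣ z := by
    apply hqu.dvd_mul_right.mp
    rw [hz, hpL]
    exact dvd_mul_right _ _
  rcases descent_second.two_adic M hzw hzM with ⟨k, hk⟩ | ⟨k, hk⟩
  · apply hn
    have : 2 ^ 1 ∣ (n : Loc) := by
      refine ⟨k * q, ?_⟩
      apply mul_left_cancel₀ h2
      linear_combination -hpL - hz + q * hk
    simpa using two_pow_dvd_of_intCast this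
  · apply hq
    apply even_of_dvd_add_mul_α (m := q - n)
    refine ⟨-k * q, ?_⟩
    apply mul_left_cancel₀ h2
    rw [map_add, map_one] at hk
    push_cast
    linear_combination hpL + hz - q * hk

end CubicInt

namespace CubicInt

/-- The linear factor of `a ^ 6 + a ^ 2 b ^ 4 + b ^ 6` in `a ^ 2` and `b ^ 2`. -/
def linFactor (a b : ℤ) : CubicInt := (a : CubicInt) ^ 2 - α * (b : CubicInt) ^ 2

/-- The quadratic factor of `a ^ 6 + a ^ 2 b ^ 4 + b ^ 6` in `a ^ 2` and `b ^ 2`. -/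
def quadFactor (a b : ℤ) : CubicInt :=
  (a : CubicInt) ^ 4 + α * (a : CubicInt) ^ 2 * (b : CubicInt) ^ 2 + -β * (b : CubicInt) ^ 4

variable {a b Y : ℤ}

lemma linFactor_mul_quadFactor (h : Y ^ 2 = a ^ 6 + a ^ 2 * b ^ 4 + b ^ 6) :
    linFactor a b * quadFactor a b = (Y : CubicInt) ^ 2 := by
  have h1 := congrArg (Int.cast : ℤ → CubicInt) h
  push_cast at h1
  unfold linFactor quadFactor
  linear_combination -h1 + (b : CubicInt) ^ 6 * α_mul_β - (a : CubicInt) ^ 2 * b ^ 4 * β_eq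

lemma norm_linFactor (h : Y ^ 2 = a ^ 6 + a ^ 2 * b ^ 4 + b ^ 6) :
    norm (linFactor a b) = Y ^ 2 := by
  have e : linFactor a b = ⟨a ^ 2, -b ^ 2, 0⟩ := by
    unfold linFactor
    ext <;> simp [pow_two]
  rw [e, h]
  simp only [norm]
  ring

lemma quadFactor_eq : quadFactor a b = linFactor a b * (a ^ 2 + 2 * α * b ^ 2)
    + (1 + 3 * α ^ 2) * (b : CubicInt) ^ 4 := by
  unfold linFactor quadFactor
  linear_combination -(b : CubicInt) ^ 4 * β_eq

lemma norm_resultant : norm (1 + 3 * α ^ 2) = 31 := by decide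

lemma prime_resultant : Prime (1 + 3 * α ^ 2) :=
  prime_of_norm (by rw [norm_resultant]; norm_num)

lemma not_prime_dvd_linFactor (hab : IsCoprime a b) {ϖ : CubicInt} (hϖ : Prime ϖ)
    (h : ϖ ∣ linFactor a b) : ¬ ϖ ∣ (b : CubicInt) := by
  intro hb
  have ha : ϖ ∣ (a : CubicInt) ^ 2 := by
    have := dvd_add h (hb.mul_left (α * b))
    convert this using 1
    unfold linFactor
    ring
  exact not_dvd_both hϖ (hab.map (Int.castRingHom CubicInt)) (hϖ.dvd_of_dvd_pow ha) hb

lemma associated_resultant (hab : IsCoprime a b) {ϖ : CubicInt} (hϖ : Prime ϖ)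
    (h : ϖ ∣ linFactor a b) (h' : ϖ ∣ quadFactor a b) : Associated ϖ (1 + 3 * α ^ 2) := by
  rw [quadFactor_eq, dvd_add_right (h.mul_right _)] at h'
  rcases hϖ.dvd_or_dvd h' with h1 | h1
  · exact hϖ.associated_of_dvd prime_resultant h1
  · exact absurd (hϖ.dvd_of_dvd_pow h1) (not_prime_dvd_linFactor hab hϖ h)

lemma sq_ne_mul_sq {p : ℕ} (hp : p.Prime) {m n : ℤ} (hm : m ≠ 0) : m ^ 2 ≠ p * n ^ 2 := by
  intro h
  have := Fact.mk hp
  have hn : n ≠ 0 := by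
    rintro rfl
    exact hm (by simpa using h)
  have h1 := congrArg (padicValInt p) h
  rw [padicValInt.mul (by exact_mod_cast hp.ne_zero) (pow_ne_zero _ hn), pow_two, pow_two,
    padicValInt.mul hm hm, padicValInt.mul hn hn, padicValInt.self hp.one_lt] at h1
  omega

lemma isCoprime_factors (hab : IsCoprime a b) (hY : Y ≠ 0)
    (h : Y ^ 2 = a ^ 6 + a ^ 2 * b ^ 4 + b ^ 6) :
    IsCoprime (linFactor a b) (quadFactor a b) := by
  have hY' : (Y : CubicInt) ≠ 0 := fun h0 => hY (congrArg CubicInt.x h0)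
  have hprod := linFactor_mul_quadFactor h
  have hπ := prime_resultant
  refine isCoprime_of_prime_dvd (fun h0 => pow_ne_zero 2 hY' (by rw [← hprod, h0.1, zero_mul])) ?_
  intro ϖ hϖ hA hB
  have has := associated_resultant hab hϖ hA hB
  rw [has.dvd_iff_dvd_left] at hA hB
  obtain ⟨A, hA'⟩ := hA
  obtain ⟨B, hB'⟩ := hB
  obtain ⟨y, hy⟩ : 1 + 3 * α ^ 2 ∣ (Y : CubicInt) :=
    hπ.dvd_of_dvd_pow ⟨A * quadFactor a b, by rw [← hprod, hA']; ring⟩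
  have hAB : A * B = y ^ 2 := by
    apply mul_left_cancel₀ (pow_ne_zero 2 hπ.ne_zero)
    rw [hA', hB', hy] at hprod
    linear_combination hprod
  have hcop : IsCoprime A B := by
    refine isCoprime_of_prime_dvd ?_ ?_
    · rintro ⟨rfl, rfl⟩
      rw [hA', mul_zero, zero_mul] at hprod
      exact pow_ne_zero 2 hY' hprod.symm
    · intro ρ hρ hρA hρB
      have hρπ := associated_resultant hab hρ (hA' ▸ hρA.mul_left _) (hB' ▸ hρB.mul_left _)
      rw [hρπ.dvd_iff_dvd_left] at hρA hρB
      have hb : 1 + 3 * α ^ 2 ∣ (b : CubicInt) ^ 4 := by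
        have e : B - A * (a ^ 2 + 2 * α * b ^ 2) = (b : CubicInt) ^ 4 := by
          apply mul_left_cancel₀ hπ.ne_zero
          linear_combination quadFactor_eq (a := a) (b := b) - hB'
            + ((a : CubicInt) ^ 2 + 2 * α * b ^ 2) * hA'
        rw [← e]
        exact dvd_sub hρB (hρA.mul_right _)
      exact not_prime_dvd_linFactor hab hπ (hA' ▸ dvd_mul_right _ _) (hπ.dvd_of_dvd_pow hb)
  obtain ⟨d, v, hv⟩ := exists_associated_pow_of_mul_eq_pow' hcop hAB
  have hn := norm_linFactor h
  rw [hA', ← hv, norm_mul, norm_mul, norm_resultant, pow_two, norm_mul, ← pow_two] at hn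
  rcases norm_of_isUnit v.isUnit with h1 | h1 <;> rw [h1] at hn
  · exact sq_ne_mul_sq (p := 31) (by norm_num) hY (n := norm d) (by rw [← hn]; push_cast; ring)
  · have := pow_pos (abs_pos.mpr hY) 2
    rw [sq_abs] at this
    nlinarith [sq_nonneg (norm d)]

/-- A unit multiple of a factor of a square that is a fourth power modulo `4` is a square. -/
lemma exists_sq_eq_of_coprime {A B y c e : CubicInt} (hc : IsUnit c) (hAB : IsCoprime A B)
    (h : A * B = y ^ 2) (he : ¬ 2 ∣ e) (h4 : 4 ∣ c * B - e ^ 4) : ∃ W, W ^ 2 = c * B := by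
  obtain ⟨d, v, hv⟩ := exists_associated_pow_of_mul_eq_pow' hAB.symm
    (show B * A = y ^ 2 by rw [mul_comm, h])
  obtain ⟨ε, hε, τ, -, hτ⟩ := exists_unit_eq (hc.mul v.isUnit)
  obtain ⟨ε', hp⟩ := exists_unitPairs hε
  have hB : c * B = ε * (τ * d) ^ 2 := by
    linear_combination -c * hv + d ^ 2 * hτ
  have h1 : ε = 1 := by
    refine unit_of_sq hp he (Q := ε * (τ * d)) ?_
    convert h4.mul_left ε using 1
    rw [hB]
    ring
  exact ⟨τ * d, by rw [hB, h1, one_mul]⟩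

lemma not_two_dvd_intCast {n : ℤ} (h : ¬ 2 ∣ n) : ¬ 2 ∣ (n : CubicInt) :=
  fun h' => h ((two_dvd_iff _).mp h').1

lemma four_dvd_intCast_sq {n : ℤ} (h : 2 ∣ n) : 4 ∣ (n : CubicInt) ^ 2 := by
  obtain ⟨k, rfl⟩ := h
  exact ⟨(k : CubicInt) ^ 2, by push_cast; ring⟩

lemma sq_eq_of_sextic (hab : IsCoprime a b) (ha : a ≠ 0) (hb : b ≠ 0)
    (h : Y ^ 2 = a ^ 6 + a ^ 2 * b ^ 4 + b ^ 6) : b ^ 2 = 4 * a ^ 2 := by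
  have hY : Y ≠ 0 := by
    rintro rfl
    have : 0 < a ^ 6 + a ^ 2 * b ^ 4 + b ^ 6 := by positivity
    rw [← h] at this
    exact lt_irrefl _ this
  have hcop := isCoprime_factors hab hY h
  have hprod := linFactor_mul_quadFactor h
  by_cases hb2 : 2 ∣ b
  · have ha2 : ¬ 2 ∣ a := fun ha2 => Int.prime_two.not_isUnit (hab.isUnit_of_dvd' ha2 hb2)
    obtain ⟨W, hW⟩ := exists_sq_eq_of_coprime isUnit_one hcop hprod (not_two_dvd_intCast ha2) (by
      convert (four_dvd_intCast_sq hb2).mul_left (α * a ^ 2 - β * b ^ 2) using 1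
      unfold quadFactor
      ring)
    refine (first_curve_points ha2 hb2 (W := W) ?_).resolve_left hb
    rw [hW, quadFactor]
    ring
  · by_cases ha2 : 2 ∣ a
    · have e : -α * quadFactor a b = (b : CubicInt) ^ 4 + -α ^ 2 * (a : CubicInt) ^ 2 * b ^ 2
          + -α * (a : CubicInt) ^ 4 := by
        unfold quadFactor
        linear_combination (b : CubicInt) ^ 4 * α_mul_β
      obtain ⟨W, hW⟩ := exists_sq_eq_of_coprime αUnit.isUnit.neg hcop hprod
        (not_two_dvd_intCast hb2) (by
          convert (four_dvd_intCast_sq ha2).mul_left (-α ^ 2 * b ^ 2 - α * a ^ 2) using 1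
          change -α * quadFactor a b - _ = _
          rw [e]
          ring)
      exact absurd (second_curve_points hb2 ha2 (hW.trans e)) ha
    · exfalso
      have h4 := congrArg (Int.cast : ℤ → ZMod 4) h
      push_cast at h4
      have key : ∀ x y z : ZMod 4, x ^ 2 = 1 → y ^ 2 = 1 → z ^ 2 ≠ x ^ 6 + x ^ 2 * y ^ 4 + y ^ 6 := by
        decide
      have odd_sq : ∀ n : ℤ, ¬ 2 ∣ n → (n : ZMod 4) ^ 2 = 1 := by
        intro n hn
        obtain ⟨k, hk⟩ : Odd n := Int.not_even_iff_odd.mp fun he => hn he.two_dvd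
        have h0 : (4 : ZMod 4) = 0 := rfl
        rw [hk]
        push_cast
        linear_combination ((k : ZMod 4) ^ 2 + k) * h0
      exact key _ _ _ (odd_sq a ha2) (odd_sq b hb2) h4

end CubicInt

/-- Diophantus' problem from Book 6 of the *Arithmetica*, resolved by Wetherell
using the method of Chabauty–Coleman: the only rational solution with `x > 0`
and `y > 0` to `y² = x⁶ + x² + 1` is `(x, y) = (1/2, 9/8)`. -/
theorem diophantus_wetherell (x y : ℚ) (hx : 0 < x) (hy : 0 < y)
    (h : y ^ 2 = x ^ 6 + x ^ 2 + 1) :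
    x = 1 / 2 ∧ y = 9 / 8 := by
  have hb : (x.den : ℚ) ≠ 0 := by exact_mod_cast x.den_ne_zero
  have hxb : x * x.den = x.num := Rat.mul_den_eq_num x
  have hY : (y * x.den ^ 3) ^ 2 =
      ((x.num ^ 6 + x.num ^ 2 * (x.den : ℤ) ^ 4 + (x.den : ℤ) ^ 6 : ℤ) : ℚ) := by
    push_cast
    rw [← hxb]
    linear_combination (x.den : ℚ) ^ 6 * h
  obtain ⟨Y, hYy⟩ : ∃ Y : ℤ, (Y : ℚ) = y * x.den ^ 3 := by
    have hsq : IsSquare ((x.num ^ 6 + x.num ^ 2 * (x.den : ℤ) ^ 4 + (x.den : ℤ) ^ 6 : ℤ) : ℚ) :=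
      ⟨_, by rw [← hY, pow_two]⟩
    obtain ⟨r, hr⟩ := Rat.isSquare_intCast_iff.mp hsq
    rw [hr, ← pow_two, Int.cast_pow, sq_eq_sq_iff_eq_or_eq_neg] at hY
    rcases hY with h1 | h1
    · exact ⟨r, h1.symm⟩
    · exact ⟨-r, by rw [h1]; push_cast; rfl⟩
  have hYZ : Y ^ 2 = x.num ^ 6 + x.num ^ 2 * (x.den : ℤ) ^ 4 + (x.den : ℤ) ^ 6 := by
    rw [← hYy] at hY
    exact_mod_cast hY
  have hkey := CubicInt.sq_eq_of_sextic (Int.isCoprime_iff_nat_coprime.mpr (by simpa using x.reduced))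
    (Rat.num_ne_zero.mpr hx.ne') (by exact_mod_cast x.den_ne_zero) hYZ
  have hkey' : (x.den : ℚ) ^ 2 = 4 * (x.num : ℚ) ^ 2 := by exact_mod_cast hkey
  have hx1 : x = 1 / 2 := by
    rw [← hxb] at hkey'
    have h4 : 4 * x ^ 2 = 1 := by
      apply mul_left_cancel₀ (pow_ne_zero 2 hb)
      linear_combination -hkey'
    nlinarith
  refine ⟨hx1, ?_⟩
  rw [hx1] at h
  nlinarith
end

section
/- Let p be an odd prime and let k, k' be even positive integers with k ≡ k' (mod p − 1) and k not divisible by p − 1. Then B_k/k ≡ B_{k'}/k' (mod p), in the sense that the rational number B_k/k − B_{k'}/k' has p-adic valuation at least 1 (equivalently, it is p-integral and its numerator is divisible by p). Here B_k denotes the k-th Bernoulli number. -/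
open Filter Topology in
/-- The normalized power sums `(∑ i < p ^ N, i ^ k) / p ^ N` converge `p`-adically to `B_k`. -/
theorem tendsto_sum_range_pow_div_bernoulli (p : ℕ) [Fact p.Prime] (k : ℕ) :
    Tendsto (fun N : ℕ => (∑ i ∈ Finset.range (p ^ N), (i : ℚ_[p]) ^ k) / (p : ℚ_[p]) ^ N)
      atTop (𝓝 ((bernoulli k : ℚ) : ℚ_[p])) := by
  have hp0 : (p : ℚ_[p]) ≠ 0 := by exact_mod_cast (Fact.out : p.Prime).ne_zero
  let f : ℚ_[p] → ℚ_[p] := fun x => ∑ i ∈ Finset.range (k + 1),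
    ((bernoulli i : ℚ) : ℚ_[p]) * ((k + 1).choose i : ℚ_[p]) * x ^ (k - i) / (k + 1)
  have hf : Continuous f := by fun_prop
  have hf0 : f 0 = ((bernoulli k : ℚ) : ℚ_[p]) := by
    have hk : (k + 1 : ℚ_[p]) ≠ 0 := by exact_mod_cast k.succ_ne_zero
    simp only [f]
    rw [Finset.sum_range_succ, Finset.sum_eq_zero]
    · simp [hk]
    · intro i hi
      have : k - i ≠ 0 := by have := Finset.mem_range.mp hi; omega
      simp [this]
  have hlim : Tendsto (fun N : ℕ => (p : ℚ_[p]) ^ N) atTop (𝓝 0) :=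
    tendsto_pow_atTop_nhds_zero_of_norm_lt_one Padic.norm_p_lt_one
  rw [← hf0]
  refine ((hf.tendsto 0).comp hlim).congr fun N => ?_
  have h := congrArg (fun q : ℚ => (q : ℚ_[p])) (sum_range_pow (p ^ N) k)
  push_cast at h
  simp only [Function.comp, f]
  rw [h, Finset.sum_div]
  refine Finset.sum_congr rfl fun i hi => ?_
  have : k + 1 - i = (k - i) + 1 := by have := Finset.mem_range.mp hi; omega
  rw [this, pow_succ]
  field_simp

/-- Multiplication by a unit modulo `M` permutes the residues modulo `M`. -/
theorem sum_range_mul_mod {R : Type*} [AddCommMonoid R] {a M : ℕ} (h : M.Coprime a)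
    (f : ℕ → R) :
    ∑ j ∈ Finset.range M, f (j * a % M) = ∑ j ∈ Finset.range M, f j := by
  have hmaps : Set.MapsTo (fun j => j * a % M) (Finset.range M) (Finset.range M) := by
    intro j hj
    simp only [Finset.coe_range, Set.mem_Iio] at hj ⊢
    exact Nat.mod_lt _ (by omega)
  have hinj : Set.InjOn (fun j => j * a % M) (Finset.range M) := by
    intro i hi j hj hij
    simp only [Finset.coe_range, Set.mem_Iio] at hi hj
    exact (Nat.ModEq.cancel_right_of_coprime h hij).eq_of_lt_of_lt hi hj
  exact Finset.sum_nbij _ hmaps hinj (Finset.surjOn_of_injOn_of_card_le _ hmaps hinj le_rfl)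
    fun _ _ => rfl

/-- The sum occurring in Voronoi's congruence for Bernoulli numbers. -/
def voronoiSum (a M k : ℕ) : ℕ :=
  ∑ j ∈ Finset.range M, (j * a % M) ^ (k - 1) * (j * a / M)

theorem exists_pow_mul_sum_range_pow_eq {a M : ℕ} (h : M.Coprime a) (k : ℕ) :
    ∃ c : ℕ, a ^ k * ∑ j ∈ Finset.range M, j ^ k =
      ∑ j ∈ Finset.range M, j ^ k + k * M * voronoiSum a M k + M ^ 2 * c := by
  choose c hc using fun j : ℕ =>
    (⟨_, (Polynomial.powAddExpansion (j * a % M) (M * (j * a / M)) k).2⟩ :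
      ∃ c, (j * a % M + M * (j * a / M)) ^ k = (j * a % M) ^ k +
        k * (j * a % M) ^ (k - 1) * (M * (j * a / M)) + c * (M * (j * a / M)) ^ 2)
  refine ⟨∑ j ∈ Finset.range M, c j * (j * a / M) ^ 2, ?_⟩
  conv_rhs => rw [← sum_range_mul_mod h (fun j => j ^ k)]
  rw [voronoiSum, Finset.mul_sum, Finset.mul_sum, Finset.mul_sum, ← Finset.sum_add_distrib,
    ← Finset.sum_add_distrib]
  refine Finset.sum_congr rfl fun j _ => ?_
  rw [← mul_pow, mul_comm a j]
  conv_lhs => rw [← Nat.mod_add_div (j * a) M, hc]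
  ring

open Filter Topology in
theorem tendsto_voronoiSum (p : ℕ) [Fact p.Prime] {a k : ℕ} (ha : p.Coprime a) (hk : k ≠ 0) :
    Tendsto (fun N : ℕ => (voronoiSum a (p ^ N) k : ℚ_[p])) atTop
      (𝓝 (((a : ℚ_[p]) ^ k - 1) * ((bernoulli k / k : ℚ) : ℚ_[p]))) := by
  have hp0 : (p : ℚ_[p]) ≠ 0 := by exact_mod_cast (Fact.out : p.Prime).ne_zero
  have hk0 : (k : ℚ_[p]) ≠ 0 := by exact_mod_cast hk
  choose c hc using fun N : ℕ => exists_pow_mul_sum_range_pow_eq (ha.pow_left N) k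
  have hlim : Tendsto (fun N : ℕ => (p : ℚ_[p]) ^ N) atTop (𝓝 0) :=
    tendsto_pow_atTop_nhds_zero_of_norm_lt_one Padic.norm_p_lt_one
  have herr : Tendsto (fun N : ℕ => (p : ℚ_[p]) ^ N * (c N : ℚ_[p])) atTop (𝓝 0) := by
    refine squeeze_zero_norm (fun N => ?_) (tendsto_zero_iff_norm_tendsto_zero.mp hlim)
    rw [norm_mul]
    exact mul_le_of_le_one_right (norm_nonneg _) (by exact_mod_cast Padic.norm_int_le_one (c N))
  have hmain := (((tendsto_sum_range_pow_div_bernoulli p k).const_mul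
    ((a : ℚ_[p]) ^ k - 1)).sub herr).div_const (k : ℚ_[p])
  rw [sub_zero, mul_div_assoc] at hmain
  push_cast
  refine hmain.congr fun N => ?_
  have h := congrArg (fun n : ℕ => (n : ℚ_[p])) (hc N)
  push_cast at h
  field_simp
  linear_combination h

theorem pow_eq_pow_of_modEq_card_sub_one {p : ℕ} [Fact p.Prime] {m n : ℕ} (hm : m ≠ 0)
    (hn : n ≠ 0) (h : m ≡ n [MOD p - 1]) (x : ZMod p) : x ^ m = x ^ n := by
  rcases eq_or_ne x 0 with rfl | hx
  · rw [zero_pow hm, zero_pow hn]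
  · exact pow_eq_pow_of_modEq h (ZMod.pow_card_sub_one_eq_one hx)

theorem Padic.norm_natCast_sub_natCast_le_inv {p : ℕ} [Fact p.Prime] {m n : ℕ}
    (h : (m : ZMod p) = n) : ‖(m : ℚ_[p]) - n‖ ≤ (p : ℝ)⁻¹ := by
  have hdvd : ((p ^ 1 : ℕ) : ℤ) ∣ (m : ℤ) - n := by
    rw [pow_one, ← ZMod.intCast_zmod_eq_zero_iff_dvd]
    simp [h]
  have := (Padic.norm_int_le_pow_iff_dvd ((m : ℤ) - n) 1).mpr (by exact_mod_cast hdvd)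
  simpa using this

theorem exists_pow_ne_one_of_not_sub_one_dvd {p : ℕ} [Fact p.Prime] {k : ℕ}
    (h : ¬ (p - 1) ∣ k) : ∃ a : ℕ, p.Coprime a ∧ (a : ZMod p) ^ k ≠ 1 := by
  obtain ⟨g, hg⟩ := IsCyclic.exists_ofOrder_eq_natCard (α := (ZMod p)ˣ)
  rw [Nat.card_eq_fintype_card, ZMod.card_units] at hg
  refine ⟨(g : ZMod p).val, (ZMod.val_coe_unit_coprime g).symm, fun hgk => h ?_⟩
  rw [← hg]
  apply orderOf_dvd_of_pow_eq_one
  ext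
  simpa using hgk

theorem voronoiSum_cast_eq {p : ℕ} [Fact p.Prime] (a M : ℕ) {k k' : ℕ} (hk : 2 ≤ k)
    (hk' : 2 ≤ k') (h : k ≡ k' [MOD p - 1]) :
    (voronoiSum a M k : ZMod p) = voronoiSum a M k' := by
  have h1 : k - 1 ≡ k' - 1 [MOD p - 1] := by
    apply Nat.ModEq.add_right_cancel' 1
    rwa [Nat.sub_add_cancel (by omega), Nat.sub_add_cancel (by omega)]
  simp only [voronoiSum, Nat.cast_sum, Nat.cast_mul, Nat.cast_pow]
  refine Finset.sum_congr rfl fun j _ => ?_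
  rw [pow_eq_pow_of_modEq_card_sub_one (by omega) (by omega) h1]

theorem Padic.norm_natCast_sub_one_eq_one {p : ℕ} [Fact p.Prime] {m : ℕ}
    (h : (m : ZMod p) ≠ 1) : ‖(m : ℚ_[p]) - 1‖ = 1 := by
  have hle : ‖(((m : ℤ) - 1 : ℤ) : ℚ_[p])‖ ≤ 1 := Padic.norm_int_le_one _
  have hnlt : ¬ ‖(((m : ℤ) - 1 : ℤ) : ℚ_[p])‖ < 1 := by
    rw [Padic.norm_intCast_lt_one_iff, ← ZMod.intCast_zmod_eq_zero_iff_dvd]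
    simpa [sub_eq_zero] using h
  simpa using le_antisymm hle (not_lt.mp hnlt)

theorem norm_bernoulli_div_sub_le_inv {p : ℕ} [Fact p.Prime] {k k' : ℕ} (hk : 2 ≤ k)
    (hk' : 2 ≤ k') (h : k ≡ k' [MOD p - 1]) (hdvd : ¬ (p - 1) ∣ k) :
    ‖((bernoulli k / k - bernoulli k' / k' : ℚ) : ℚ_[p])‖ ≤ (p : ℝ)⁻¹ := by
  obtain ⟨a, ha, hak⟩ := exists_pow_ne_one_of_not_sub_one_dvd hdvd
  have hpow := pow_eq_pow_of_modEq_card_sub_one (by omega) (by omega) h (a : ZMod p)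
  have hu := Padic.norm_natCast_sub_one_eq_one (m := a ^ k) (by exact_mod_cast hak)
  have hu' := Padic.norm_natCast_sub_one_eq_one (m := a ^ k') (by
    push_cast
    rwa [← hpow])
  have huu' := Padic.norm_natCast_sub_natCast_le_inv (m := a ^ k') (n := a ^ k) (by
    push_cast
    exact hpow.symm)
  have hT := tendsto_voronoiSum p ha (k := k) (by omega)
  have hT' := tendsto_voronoiSum p ha (k := k') (by omega)
  push_cast at hu hu' huu' hT hT' ⊢
  set b : ℚ_[p] := (bernoulli k : ℚ_[p]) / k
  set b' : ℚ_[p] := (bernoulli k' : ℚ_[p]) / k'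
  have hb' : ‖b'‖ ≤ 1 := by
    have := le_of_tendsto' hT'.norm fun N => Padic.norm_int_le_one (voronoiSum a (p ^ N) k')
    rwa [norm_mul, hu', one_mul] at this
  have hsub : ‖((a : ℚ_[p]) ^ k - 1) * b - ((a : ℚ_[p]) ^ k' - 1) * b'‖ ≤ (p : ℝ)⁻¹ :=
    le_of_tendsto' (hT.sub hT').norm fun N =>
      Padic.norm_natCast_sub_natCast_le_inv (voronoiSum_cast_eq a (p ^ N) hk hk' h)
  calc ‖b - b'‖ = ‖((a : ℚ_[p]) ^ k - 1) * (b - b')‖ := by rw [norm_mul, hu, one_mul]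
    _ = ‖(((a : ℚ_[p]) ^ k - 1) * b - ((a : ℚ_[p]) ^ k' - 1) * b') +
          ((a : ℚ_[p]) ^ k' - (a : ℚ_[p]) ^ k) * b'‖ := by ring_nf
    _ ≤ _ := Padic.nonarchimedean _ _
    _ ≤ (p : ℝ)⁻¹ := max_le hsub (by
      rw [norm_mul]
      exact (mul_le_of_le_one_right (norm_nonneg _) hb').trans huu')

theorem one_le_padicValRat_of_norm_le_inv {p : ℕ} [Fact p.Prime] {q : ℚ} (hq : q ≠ 0)
    (h : ‖(q : ℚ_[p])‖ ≤ (p : ℝ)⁻¹) : 1 ≤ padicValRat p q := by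
  have hp1 : (1 : ℝ) < p := by exact_mod_cast (Fact.out : p.Prime).one_lt
  rw [Padic.eq_padicNorm, padicNorm.eq_zpow_of_nonzero hq] at h
  push_cast at h
  rw [← zpow_neg_one, zpow_le_zpow_iff_right₀ hp1] at h
  omega

/-- The classical Kummer congruence for Bernoulli numbers: for an odd prime `p`
and even positive integers `k ≡ k' (mod p - 1)` with `k` not divisible by
`p - 1`, one has `B_k / k ≡ B_{k'} / k' (mod p)`, i.e. the rational number
`B_k / k - B_{k'} / k'` is zero or has `p`-adic valuation at least `1`. -/
theorem kummer_congruence (p : ℕ) (hp : p.Prime) (hodd : Odd p)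
    (k k' : ℕ) (hk : 0 < k) (hk' : 0 < k') (hke : Even k) (hk'e : Even k')
    (hkk' : k ≡ k' [MOD p - 1]) (hdvd : ¬ (p - 1) ∣ k) :
    bernoulli k / k - bernoulli k' / k' = 0 ∨
      1 ≤ padicValRat p (bernoulli k / k - bernoulli k' / k') := by
  have : Fact p.Prime := ⟨hp⟩
  have hk2 : 2 ≤ k := Nat.le_of_dvd hk hke.two_dvd
  have hk'2 : 2 ≤ k' := Nat.le_of_dvd hk' hk'e.two_dvd
  exact or_iff_not_imp_left.mpr fun hne =>
    one_le_padicValRat_of_norm_le_inv hne (norm_bernoulli_div_sub_le_inv hk2 hk'2 hkk' hdvd)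
end
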